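/- arXiv:math/0601714 — 3 statements merged into one kernel-verified Lean document; each statement's English description precedes it below -/
import Mathlib

section
/- Let Δ ⊂ ℝⁿ be a convex polytope with vertices in ℤⁿ. Then the function N ↦ #( (N·Δ) ∩ ℤⁿ ), defined for positive integers N, is a polynomial in N of degree n (Ehrhart's theorem). -/
open Pointwise

namespace Ehr

/-- first nonzero entry is positive -/
def LexPos {k : ℕ} (d : Fin k → ℝ) : Prop := ∃ i, (∀ j < i, d j = 0) ∧ 0 < d i

/-- the linear map with columns `w` -/
def A {k n : ℕ} (w : Fin k → Fin n → ℤ) (l : Fin k → ℝ) : Fin n → ℝ :=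
  fun i => ∑ v, l v * (w v i : ℝ)

/-- `l` is the lexicographic minimum of its fibre -/
def Opt {k n : ℕ} (w : Fin k → Fin n → ℤ) (l : Fin k → ℝ) : Prop :=
  (∀ v, 0 ≤ l v) ∧ ∀ m : Fin k → ℝ, (∀ v, 0 ≤ m v) → A w m = A w l → ∑ v, m v = ∑ v, l v →
    m ≠ l → LexPos (m - l)

lemma lexPos_asymm {k : ℕ} {d e : Fin k → ℝ} (h : LexPos (d - e)) (h' : LexPos (e - d)) :
    False := by
  obtain ⟨i, hi, hi'⟩ := h
  obtain ⟨j, hj, hj'⟩ := h'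
  simp only [Pi.sub_apply] at *
  rcases lt_trichotomy i j with h | h | h
  · linarith [hj i h]
  · subst h; linarith
  · linarith [hi j h]

lemma Opt.unique {k n : ℕ} {w : Fin k → Fin n → ℤ} {l m : Fin k → ℝ} (hl : Opt w l)
    (hm : Opt w m) (hA : A w l = A w m) (hs : ∑ v, l v = ∑ v, m v) : l = m := by
  by_contra hne
  exact lexPos_asymm (hl.2 m hm.1 hA.symm hs.symm (Ne.symm hne)) (hm.2 l hl.1 hA hs hne)

lemma A_add {k n : ℕ} (w : Fin k → Fin n → ℤ) (l m : Fin k → ℝ) :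
    A w (l + m) = A w l + A w m := by
  ext i; simp [A, add_mul, Finset.sum_add_distrib]

lemma A_sub {k n : ℕ} (w : Fin k → Fin n → ℤ) (l m : Fin k → ℝ) :
    A w (l - m) = A w l - A w m := by
  ext i; simp [A, sub_mul, Finset.sum_sub_distrib]

lemma A_smul {k n : ℕ} (w : Fin k → Fin n → ℤ) (c : ℝ) (l : Fin k → ℝ) :
    A w (c • l) = c • A w l := by
  ext i; simp [A, mul_assoc, Finset.mul_sum]

lemma exists_eps {k : ℕ} (l m : Fin k → ℝ) (hl : ∀ v, 0 ≤ l v)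
    (hm : ∀ v, 0 ≤ m v) (hsupp : ∀ v, l v = 0 → m v = 0) :
    ∃ ε : ℝ, 0 < ε ∧ ∀ v, ε * m v ≤ l v := by
  classical
  have key : ∀ s : Finset (Fin k), ∃ ε : ℝ, 0 < ε ∧ ∀ v ∈ s, ε * m v ≤ l v := by
    intro s
    induction s using Finset.induction_on with
    | empty => exact ⟨1, one_pos, by simp⟩
    | insert a s ha ih =>
      obtain ⟨ε, h0, h⟩ := ih
      by_cases hz : m a = 0
      · refine ⟨ε, h0, fun v hv => ?_⟩
        rcases Finset.mem_insert.1 hv with rfl | hv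
        · rw [hz, mul_zero]; exact hl _
        · exact h v hv
      · have hma : 0 < m a := lt_of_le_of_ne (hm a) (Ne.symm hz)
        have hla : 0 < l a := lt_of_le_of_ne (hl a) (fun h => hz (hsupp a h.symm))
        refine ⟨min ε (l a / m a), lt_min h0 (div_pos hla hma), fun v hv => ?_⟩
        rcases Finset.mem_insert.1 hv with rfl | hv
        · calc _ ≤ l v / m v * m v := by gcongr; exact min_le_right _ _
            _ = l v := by field_simp
        · calc _ ≤ ε * m v := mul_le_mul_of_nonneg_right (min_le_left _ _) (hm v)
            _ ≤ _ := h v hv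
  obtain ⟨ε, h0, h⟩ := key Finset.univ
  exact ⟨ε, h0, fun v => h v (Finset.mem_univ v)⟩

lemma Opt.mono {k n : ℕ} {w : Fin k → Fin n → ℤ} {l m : Fin k → ℝ} (hl : Opt w l)
    (hm : ∀ v, 0 ≤ m v) (hsupp : ∀ v, l v = 0 → m v = 0) : Opt w m := by
  refine ⟨hm, fun p hp hA hs hne => ?_⟩
  obtain ⟨ε, h0, hε⟩ := exists_eps l m hl.1 hm hsupp
  have h := hl.2 (l + ε • (p - m)) (fun v => ?_) ?_ ?_ ?_
  · obtain ⟨i, hi, hi'⟩ := h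
    refine ⟨i, fun j hj => ?_, ?_⟩
    · have := hi j hj
      simp [h0.ne'] at this
      simpa using this
    · simpa [h0] using hi'
  · have := hε v
    have := mul_nonneg h0.le (hp v)
    simp only [Pi.add_apply, Pi.smul_apply, Pi.sub_apply, smul_eq_mul]
    linarith
  · rw [A_add, A_smul, A_sub, hA]; simp
  · simp [Finset.sum_add_distrib, ← Finset.mul_sum, hs]
  · intro h
    apply hne
    have : ε • (p - m) = 0 := by simpa using h
    rcases smul_eq_zero.1 this with h | h
    · exact absurd h h0.ne'
    · exact sub_eq_zero.1 h

lemma exists_lexmin {k : ℕ} (K : Set (Fin k → ℝ)) (hK : IsCompact K) (hne : K.Nonempty) :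
    ∃ l ∈ K, ∀ m ∈ K, m ≠ l → LexPos (m - l) := by
  have key : ∀ r : ℕ, r ≤ k → ∃ L ⊆ K, IsCompact L ∧ L.Nonempty ∧ ∀ l ∈ L, ∀ m ∈ K,
      LexPos (m - l) ∨ (m ∈ L ∧ ∀ j : Fin k, j.1 < r → m j = l j) := by
    intro r
    induction r with
    | zero => exact fun _ => ⟨K, subset_rfl, hK, hne, fun l _ m hm => Or.inr ⟨hm, by simp⟩⟩
    | succ r ih =>
      intro hr
      obtain ⟨L, hLK, hL, hLn, h⟩ := ih (by omega)
      obtain ⟨x, hx, hmin⟩ := hL.exists_isMinOn hLn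
        (f := fun l : Fin k → ℝ => l ⟨r, hr⟩) (by fun_prop)
      refine ⟨L ∩ {l | l ⟨r, hr⟩ = x ⟨r, hr⟩}, fun _ h => hLK h.1,
        hL.inter_right (isClosed_eq (by fun_prop) (by fun_prop)), ⟨x, hx, rfl⟩, ?_⟩
      rintro l ⟨hl, hl'⟩ m hm
      rcases h l hl m hm with h | ⟨hmL, heq⟩
      · exact Or.inl h
      · have h1 : x ⟨r, hr⟩ ≤ m ⟨r, hr⟩ := hmin hmL
        change l _ = x _ at hl'
        rcases h1.eq_or_lt with h1 | h1
        · refine Or.inr ⟨⟨hmL, h1.symm⟩, fun j hj => ?_⟩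
          rcases (Nat.lt_succ_iff_lt_or_eq.1 hj) with hj | hj
          · exact heq j hj
          · have : j = ⟨r, hr⟩ := Fin.ext hj
            rw [this, hl', h1]
        · refine Or.inl ⟨⟨r, hr⟩, fun j hj => ?_, ?_⟩
          · simp [heq j hj]
          · simp only [Pi.sub_apply]; linarith
  obtain ⟨L, hLK, -, ⟨l, hl⟩, h⟩ := key k le_rfl
  refine ⟨l, hLK hl, fun m hm hne => ?_⟩
  rcases h l hl m hm with h | ⟨-, h⟩
  · exact h
  · exact absurd (funext fun j => h j j.2) hne

lemma exists_opt {k n : ℕ} (w : Fin k → Fin n → ℤ) (l : Fin k → ℝ) (hl : ∀ v, 0 ≤ l v) :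
    ∃ m, Opt w m ∧ A w m = A w l ∧ ∑ v, m v = ∑ v, l v := by
  have hcont : Continuous (A w) := by unfold A; fun_prop
  obtain ⟨m, ⟨hm, hmA, hms⟩, h⟩ := exists_lexmin
    (Set.Icc (0 : Fin k → ℝ) (fun _ => ∑ v, l v) ∩ ({m | A w m = A w l} ∩
      {m | ∑ v, m v = ∑ v, l v}))
    (isCompact_Icc.inter_right ((isClosed_eq hcont continuous_const).inter
      (isClosed_eq (by fun_prop) continuous_const)))
    ⟨l, ⟨hl, fun v => Finset.single_le_sum (fun v _ => hl v) (Finset.mem_univ v)⟩, rfl, rfl⟩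
  refine ⟨m, ⟨hm.1, fun p hp hpA hps hne => h p ⟨⟨hp, fun v => ?_⟩, ?_, ?_⟩ hne⟩, hmA, hms⟩
  · rw [← hms, ← hps]
    exact Finset.single_le_sum (fun v _ => hp v) (Finset.mem_univ v)
  · exact hpA.trans hmA
  · exact hps.trans hms

lemma card_poly {k : ℕ} (s : Finset (Fin k)) (h : ℕ) (h1 : 1 ≤ h) (h2 : h ≤ s.card) (N : ℕ)
    (hN : 0 < N) :
    (((if h ≤ N then s.finsuppAntidiag (N - h) else ∅ : Finset (Fin k →₀ ℕ)).card : ℕ) : ℚ)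
      = (Polynomial.preHilbertPoly ℚ (s.card - 1) h).eval (N : ℚ) := by
  split_ifs with hh
  · rw [Polynomial.preHilbertPoly_eq_choose_sub_add _ _ hh,
      Finset.card_finsuppAntidiag_nat_eq_choose]
    congr 1
    rw [show s.card + (N - h) - 1 = N - h + (s.card - 1) by omega, Nat.choose_symm_add]
  · have e : (N : ℚ) - h + 1 = -((h - 1 - N : ℕ) : ℚ) := by
      rw [Nat.sub_sub, Nat.cast_sub (by omega)]; push_cast; ring
    simp only [Polynomial.preHilbertPoly, Polynomial.eval_smul, Polynomial.eval_comp,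
      Polynomial.eval_add, Polynomial.eval_sub, Polynomial.eval_X, Polynomial.eval_C,
      Polynomial.eval_one, e]
    rw [ascPochhammer_eval_neg_coe_nat_of_lt (by omega)]
    simp

end Ehr
namespace Ehr

/-- lattice points of the `N`-th dilate -/
def S {k n : ℕ} (w : Fin k → Fin n → ℤ) (N : ℕ) : Set (Fin n → ℝ) :=
  {x | (∃ z : Fin n → ℤ, ∀ i, x i = z i) ∧
    ∃ l : Fin k → ℝ, (∀ v, 0 ≤ l v) ∧ A w l = x ∧ ∑ v, l v = N}

/-- the box points -/
def Box {k n : ℕ} (w : Fin k → Fin n → ℤ) : Set (Fin k → ℝ) :=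
  {b | Opt w b ∧ (∀ v, b v ≤ 1) ∧ (∃ z : Fin n → ℤ, ∀ i, A w b i = z i) ∧
    (∃ h : ℕ, ∑ v, b v = h) ∧ b ≠ 0}

lemma box_finite {k n : ℕ} (w : Fin k → Fin n → ℤ) : (Box w).Finite := by
  let M : Fin n → ℤ := fun i => ∑ v, |w v i|
  let g : (Fin k → ℝ) → (Fin n → ℤ) × ℕ := fun b => (fun i => ⌊A w b i⌋, ⌊∑ v, b v⌋₊)
  refine Set.Finite.of_injOn (f := g) (t := Set.Icc (-M) M ×ˢ Set.Icc 0 k) ?_ ?_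
    ((Set.finite_Icc _ _).prod (Set.finite_Icc _ _))
  · rintro b ⟨hb, hb1, ⟨z, hz⟩, ⟨h, hh⟩, -⟩
    have hle : ∀ i, |z i| ≤ M i := by
      intro i
      have : |A w b i| ≤ (M i : ℝ) := by
        simp only [A, M]
        push_cast
        refine (Finset.abs_sum_le_sum_abs _ _).trans (Finset.sum_le_sum fun v _ => ?_)
        rw [abs_mul, abs_of_nonneg (hb.1 v)]
        exact mul_le_of_le_one_left (abs_nonneg _) (hb1 v)
      rw [hz] at this
      exact_mod_cast this
    have hk : h ≤ k := by
      have : (h : ℝ) ≤ k := by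
        rw [← hh]
        calc _ ≤ ∑ v : Fin k, (1 : ℝ) := Finset.sum_le_sum fun v _ => hb1 v
          _ = k := by simp
      exact_mod_cast this
    have hg : g b = (z, h) := by
      simp only [g, hh, Nat.floor_natCast]
      congr 1
      ext i
      rw [hz, Int.floor_intCast]
    rw [hg]
    exact ⟨⟨fun i => (abs_le.1 (hle i)).1, fun i => (abs_le.1 (hle i)).2⟩, Nat.zero_le _, hk⟩
  · rintro b ⟨hb, hb1, ⟨z, hz⟩, ⟨h, hh⟩, -⟩ c ⟨hc, hc1, ⟨y, hy⟩, ⟨h', hh'⟩, -⟩ hbc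
    simp only [g, Prod.mk.injEq, hh, hh', Nat.floor_natCast] at hbc
    refine hb.unique hc ?_ ?_
    · ext i
      have := congrFun hbc.1 i
      simp only [hz, hy, Int.floor_intCast] at this
      rw [hz, hy, this]
    · rw [hh, hh', hbc.2]

/-- support as a finset -/
noncomputable def supp {k : ℕ} (b : Fin k → ℝ) : Finset (Fin k) :=
  Finset.univ.filter fun v => b v ≠ 0

/-- height -/
noncomputable def ht {k : ℕ} (b : Fin k → ℝ) : ℕ := ⌊∑ v, b v⌋₊

/-- the multiplicity vectors -/
noncomputable def mult {k : ℕ} (N : ℕ) (b : Fin k → ℝ) : Finset (Fin k →₀ ℕ) :=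
  if ht b ≤ N then (supp b).finsuppAntidiag (N - ht b) else ∅

lemma mem_mult {k n : ℕ} {w : Fin k → Fin n → ℤ} {N : ℕ} {b : Fin k → ℝ} (hb : b ∈ Box w)
    (m : Fin k →₀ ℕ) :
    m ∈ mult N b ↔ (∑ v, (b v + m v) = N) ∧ ∀ v, b v = 0 → m v = 0 := by
  obtain ⟨hb, hb1, -, ⟨h, hh⟩, -⟩ := hb
  have hht : ht b = h := by simp [ht, hh]
  have hsupp : (∀ v, b v = 0 → m v = 0) ↔ m.support ⊆ supp b := by
    simp only [Finset.subset_iff, supp, Finset.mem_filter, Finset.mem_univ, true_and,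
      Finsupp.mem_support_iff]
    exact forall_congr' fun v => not_imp_not.symm
  have hsum : (∑ v, (b v + m v) = N) ↔ h + ∑ v, m v = N := by
    rw [Finset.sum_add_distrib, hh]; exact_mod_cast Iff.rfl
  have hs2 : m.support ⊆ supp b → ∑ v, m v = (supp b).sum m := fun hs =>
    (Finset.sum_subset (Finset.subset_univ _) fun v _ hv => by
      by_contra hne
      exact hv (hs (Finsupp.mem_support_iff.2 hne))).symm
  rw [hsupp, hsum, mult, hht]
  split_ifs with hN
  · rw [Finset.mem_finsuppAntidiag]
    constructor
    · rintro ⟨h1, h2⟩; exact ⟨by rw [hs2 h2]; omega, h2⟩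
    · rintro ⟨h1, h2⟩; exact ⟨by rw [hs2 h2] at h1; omega, h2⟩
  · simp only [Finset.notMem_empty, false_iff]
    rintro ⟨h1, -⟩; omega

lemma add_inj {b c : ℝ} {p q : ℕ} (hb : 0 ≤ b) (hb1 : b ≤ 1) (hc : 0 ≤ c) (hc1 : c ≤ 1)
    (hp : b = 0 → p = 0) (hq : c = 0 → q = 0) (h : b + p = c + q) : b = c ∧ p = q := by
  suffices p = q by subst this; exact ⟨by linarith, rfl⟩
  rcases hb.eq_or_lt with hb | hb
  · have := hp hb.symm
    subst this
    have : (q : ℝ) ≤ 0 := by push_cast at h; linarith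
    have : q ≤ 0 := by exact_mod_cast this
    omega
  rcases hc.eq_or_lt with hc | hc
  · have := hq hc.symm
    subst this
    have : (p : ℝ) ≤ 0 := by push_cast at h; linarith
    have : p ≤ 0 := by exact_mod_cast this
    omega
  have h1 : (p : ℝ) < q + 1 := by linarith
  have h2 : (q : ℝ) < p + 1 := by linarith
  norm_cast at h1 h2
  omega

lemma count {k n : ℕ} (w : Fin k → Fin n → ℤ) (N : ℕ) (hN : 0 < N) :
    (S w N).ncard = ∑ b ∈ (box_finite w).toFinset, (mult N b).card := by
  classical
  let f : (Σ _ : Fin k → ℝ, Fin k →₀ ℕ) → (Fin n → ℝ) := fun p => A w (p.1 + fun v => (p.2 v : ℝ))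
  rw [← Finset.card_sigma]
  have hopt : ∀ b ∈ Box w, ∀ m ∈ mult N b, Opt w (b + fun v => (m v : ℝ)) := by
    intro b hb m hm
    refine hb.1.mono (fun v => add_nonneg (hb.1.1 v) (Nat.cast_nonneg _)) fun v hv => ?_
    simp [hv, ((mem_mult hb m).1 hm).2 v hv]
  have hinj : Set.InjOn f ((box_finite w).toFinset.sigma (mult N)) := by
    rintro ⟨b, m⟩ h1 ⟨c, q⟩ h2 h
    simp only [Finset.coe_sigma, Set.mem_sigma_iff, Finset.mem_coe,
      Set.Finite.mem_toFinset] at h1 h2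
    obtain ⟨hb, hm⟩ := h1
    obtain ⟨hc, hq⟩ := h2
    have e := (hopt b hb m hm).unique (hopt c hc q hq) h
      (((mem_mult hb m).1 hm).1.trans ((mem_mult hc q).1 hq).1.symm)
    have e' : ∀ v, b v = c v ∧ m v = q v := fun v =>
      add_inj (hb.1.1 v) (hb.2.1 v) (hc.1.1 v) (hc.2.1 v) (((mem_mult hb m).1 hm).2 v)
        (((mem_mult hc q).1 hq).2 v) (congrFun e v)
    have e1 : b = c := funext fun v => (e' v).1
    have e2 : m = q := Finsupp.ext fun v => (e' v).2
    rw [e1, e2]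
  rw [← Finset.card_image_of_injOn hinj, ← Set.ncard_coe_finset]
  congr 1
  ext x
  simp only [Finset.coe_image, Set.mem_image, Finset.mem_coe, Finset.mem_sigma,
    Set.Finite.mem_toFinset, Sigma.exists]
  constructor
  · rintro ⟨⟨z, hz⟩, l0, hl0, rfl, hs0⟩
    obtain ⟨l, hl, hA, hs⟩ := exists_opt w l0 hl0
    rw [← hA] at hz ⊢
    rw [hs0] at hs
    let m : Fin k →₀ ℕ := Finsupp.equivFunOnFinite.symm fun v => ⌈l v⌉₊ - 1
    let b : Fin k → ℝ := l - fun v => (m v : ℝ)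
    have hm : ∀ v, m v = ⌈l v⌉₊ - 1 := fun v => rfl
    have hbv : ∀ v, b v = l v - m v := fun v => rfl
    have hlb : b + (fun v => (m v : ℝ)) = l := by simp [b]
    have hz0 : ∀ v, l v = 0 → m v = 0 ∧ b v = 0 := by
      intro v hv
      have : m v = 0 := by simp [hm, hv]
      exact ⟨this, by simp [hbv, hv, this]⟩
    have hpos : ∀ v, 0 < l v → 0 < b v ∧ b v ≤ 1 := by
      intro v hv
      have h1 : 1 ≤ ⌈l v⌉₊ := Nat.one_le_iff_ne_zero.2 (Nat.ceil_pos.2 hv).ne'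
      have h2 := Nat.le_ceil (l v)
      have h3 := Nat.ceil_lt_add_one hv.le
      rw [hbv, hm, Nat.cast_sub h1]
      push_cast
      constructor <;> linarith
    have hb0 : ∀ v, 0 ≤ b v ∧ b v ≤ 1 := by
      intro v
      rcases (hl.1 v).eq_or_lt with h | h
      · rw [(hz0 v h.symm).2]; simp
      · exact ⟨(hpos v h).1.le, (hpos v h).2⟩
    have hbl : ∀ v, b v = 0 → l v = 0 := by
      intro v h
      rcases (hl.1 v).eq_or_lt with h' | h'
      · exact h'.symm
      · exact absurd h (hpos v h').1.ne'
    have hsb : ∑ v, b v + ((∑ v, m v : ℕ) : ℝ) = N := by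
      push_cast
      rw [← Finset.sum_add_distrib, ← hs]
      exact Finset.sum_congr rfl fun v _ => congrFun hlb v
    have hbox : b ∈ Box w := by
      refine ⟨hl.mono (fun v => (hb0 v).1) fun v hv => (hz0 v hv).2, fun v => (hb0 v).2,
        ⟨fun i => z i - ∑ v, (m v : ℤ) * w v i, fun i => ?_⟩, ⟨N - ∑ v, m v, ?_⟩, ?_⟩
      · simp only [b, A_sub, Pi.sub_apply, hz]
        simp [A]
      · have : ∑ v, m v ≤ N := by
          have h0 : 0 ≤ ∑ v, b v := Finset.sum_nonneg fun v _ => (hb0 v).1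
          have : ((∑ v, m v : ℕ) : ℝ) ≤ N := by linarith
          exact_mod_cast this
        rw [Nat.cast_sub this]; linarith
      · intro h
        have : ∀ v, l v = 0 := fun v => hbl v (congrFun h v)
        simp only [this, Finset.sum_const_zero] at hs
        exact hN.ne' (by exact_mod_cast hs.symm)
    refine ⟨b, m, ⟨hbox, (mem_mult hbox m).2 ⟨?_, fun v hv => (hz0 v (hbl v hv)).1⟩⟩, ?_⟩
    · rw [Finset.sum_add_distrib]; exact_mod_cast hsb
    · simp only [f, hlb]
  · rintro ⟨b, m, ⟨hb, hm⟩, rfl⟩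
    have ho := hopt b hb m hm
    obtain ⟨-, -, ⟨z, hz⟩, -⟩ := id hb
    refine ⟨⟨fun i => z i + ∑ v, (m v : ℤ) * w v i, fun i => ?_⟩, _, ho.1, rfl,
      ((mem_mult hb m).1 hm).1⟩
    simp only [f, A_add, Pi.add_apply, hz]
    simp [A]

lemma exists_poly {k n : ℕ} (w : Fin k → Fin n → ℤ) :
    ∃ p : Polynomial ℚ, ∀ N : ℕ, 0 < N → ((S w N).ncard : ℚ) = p.eval (N : ℚ) := by
  refine ⟨∑ b ∈ (box_finite w).toFinset,
    Polynomial.preHilbertPoly ℚ ((supp b).card - 1) (ht b), fun N hN => ?_⟩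
  rw [count w N hN, Polynomial.eval_finsetSum]
  push_cast
  refine Finset.sum_congr rfl fun b hb => ?_
  rw [Set.Finite.mem_toFinset] at hb
  obtain ⟨ho, hb1, -, ⟨h, hh⟩, hne⟩ := hb
  have hht : ht b = h := by simp [ht, hh]
  refine card_poly _ _ ?_ ?_ N hN
  · rw [hht, Nat.one_le_iff_ne_zero]
    rintro rfl
    apply hne
    rw [Nat.cast_zero, Finset.sum_eq_zero_iff_of_nonneg fun v _ => ho.1 v] at hh
    exact funext fun v => hh v (Finset.mem_univ v)
  · rw [hht]
    have : (h : ℝ) ≤ (supp b).card := by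
      rw [← hh, ← Finset.sum_subset (Finset.subset_univ (supp b))
        (fun v _ hv => by simpa [supp] using hv)]
      calc _ ≤ ∑ v ∈ supp b, (1 : ℝ) := Finset.sum_le_sum fun v _ => hb1 v
        _ = _ := by simp
    exact_mod_cast this

end Ehr
namespace Ehr

lemma degree_eq (p : Polynomial ℚ) (n : ℕ) (C q : ℕ) (hq : 0 < q)
    (hup : ∀ N : ℕ, 0 < N → p.eval (N : ℚ) ≤ ((C : ℚ) * N) ^ n)
    (hlo : ∀ t : ℕ, 0 < t → (t : ℚ) ^ n ≤ p.eval ((q * t : ℕ) : ℚ)) : p.natDegree = n := by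
  have hX : (Polynomial.X ^ n : Polynomial ℚ) ≠ 0 := pow_ne_zero _ Polynomial.X_ne_zero
  have hdX : (Polynomial.X ^ n : Polynomial ℚ).degree = n := Polynomial.degree_X_pow n
  have hT : Filter.Tendsto (fun t : ℕ => ((q * t : ℕ) : ℚ)) Filter.atTop Filter.atTop := by
    refine tendsto_natCast_atTop_atTop.comp ?_
    exact Filter.tendsto_id.const_mul_atTop' hq
  have hqQ : (0 : ℚ) < q := by exact_mod_cast hq
  have hqn : (0 : ℚ) < (q : ℚ) ^ n := by positivity
  have hbd : ∀ t : ℕ, 0 < t → ((q : ℚ) ^ n)⁻¹ ≤ p.eval ((q * t : ℕ) : ℚ) /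
      (Polynomial.X ^ n : Polynomial ℚ).eval ((q * t : ℕ) : ℚ) ∧ p.eval ((q * t : ℕ) : ℚ) /
      (Polynomial.X ^ n : Polynomial ℚ).eval ((q * t : ℕ) : ℚ) ≤ (C : ℚ) ^ n := by
    intro t ht
    have h1 := hlo t ht
    have h2 := hup (q * t) (by positivity)
    have htQ : (0 : ℚ) < t := by exact_mod_cast ht
    have h3 : (0 : ℚ) < ((q * t : ℕ) : ℚ) ^ n := by positivity
    rw [Polynomial.eval_pow, Polynomial.eval_X]
    constructor
    · rw [le_div_iff₀ h3]
      calc _ = (t : ℚ) ^ n := by push_cast; rw [mul_pow]; field_simp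
        _ ≤ _ := h1
    · rw [div_le_iff₀ h3, ← mul_pow]; exact h2
  apply Polynomial.natDegree_eq_of_degree_eq_some
  rcases lt_trichotomy p.degree (n : WithBot ℕ) with h | h | h
  · exfalso
    have := (Polynomial.div_tendsto_atTop_zero_of_degree_lt p (Polynomial.X ^ n) (by rwa [hdX])).comp hT
    have h1 : ((q : ℚ) ^ n)⁻¹ ≤ 0 := by
      refine ge_of_tendsto this ?_
      filter_upwards [Filter.eventually_gt_atTop 0] with t ht
      exact (hbd t ht).1
    have : 0 < ((q : ℚ) ^ n)⁻¹ := by positivity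
    linarith
  · exact h
  · exfalso
    have := (Polynomial.abs_div_tendsto_atTop_atTop_of_degree_gt p (Polynomial.X ^ n)
      (by rwa [hdX]) hX).comp hT
    obtain ⟨t, ht, ht'⟩ := ((this.eventually_gt_atTop ((C : ℚ) ^ n)).and
      (Filter.eventually_gt_atTop 0)).exists
    have hb := hbd t ht'
    have : 0 < ((q : ℚ) ^ n)⁻¹ := by positivity
    simp only [Function.comp] at ht
    rw [abs_of_nonneg (by linarith)] at ht
    linarith

lemma upper {k n : ℕ} (w : Fin k → Fin n → ℤ) :
    ∃ C : ℕ, ∀ N : ℕ, 0 < N → (S w N).Finite ∧ (S w N).ncard ≤ (C * N) ^ n := by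
  classical
  let M : ℕ := ∑ v, ∑ i, (w v i).natAbs
  refine ⟨2 * M + 1, fun N hN => ?_⟩
  have hw : ∀ v i, |(w v i : ℝ)| ≤ M := by
    intro v i
    have : (w v i).natAbs ≤ M :=
      (Finset.single_le_sum (f := fun i => (w v i).natAbs) (fun _ _ => Nat.zero_le _)
        (Finset.mem_univ i)).trans
      (Finset.single_le_sum (f := fun v => ∑ i, (w v i).natAbs) (fun _ _ => Nat.zero_le _)
        (Finset.mem_univ v))
    rw [← Int.cast_abs, Int.abs_eq_natAbs]
    exact_mod_cast this
  let T : Finset (Fin n → ℤ) := Fintype.piFinset fun _ => Finset.Icc (-(M * N : ℤ)) (M * N)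
  have hsub : S w N ⊆ ((T.image fun (z : Fin n → ℤ) (i : Fin n) => (z i : ℝ)) :
      Finset (Fin n → ℝ)) := by
    rintro x ⟨⟨z, hz⟩, l, hl, rfl, hs⟩
    rw [Finset.mem_coe, Finset.mem_image]
    refine ⟨z, ?_, funext fun i => (hz i).symm⟩
    rw [Fintype.mem_piFinset]
    intro i
    rw [Finset.mem_Icc, ← abs_le]
    have : |A w l i| ≤ M * N := by
      simp only [A]
      refine (Finset.abs_sum_le_sum_abs _ _).trans ?_
      rw [← hs, Finset.mul_sum]
      refine Finset.sum_le_sum fun v _ => ?_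
      rw [abs_mul, abs_of_nonneg (hl v), mul_comm]
      exact mul_le_mul_of_nonneg_right (hw v i) (hl v)
    rw [hz] at this
    exact_mod_cast this
  refine ⟨(Finset.finite_toSet _).subset hsub, ?_⟩
  calc _ ≤ _ := Set.ncard_le_ncard hsub (Finset.finite_toSet _)
    _ ≤ T.card := by rw [Set.ncard_coe_finset]; exact Finset.card_image_le
    _ = (2 * M * N + 1) ^ n := by
      simp only [T, Fintype.card_piFinset, Int.card_Icc, Finset.prod_const, Finset.card_univ,
        Fintype.card_fin]
      congr 1
      have : (M * N : ℤ) + 1 - -(M * N) = ((2 * M * N + 1 : ℕ) : ℤ) := by push_cast; ring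
      rw [this, Int.toNat_natCast]
    _ ≤ _ := Nat.pow_le_pow_left (by nlinarith) n

lemma lower {n : ℕ} (D : Set (Fin n → ℝ)) (h : (interior D).Nonempty) :
    ∃ q : ℕ, 0 < q ∧ ∀ t : ℕ, 0 < t →
      ((((q * t : ℕ) : ℝ) • D) ∩ Set.range fun (z : Fin n → ℤ) (i : Fin n) => (z i : ℝ)).Finite →
      t ^ n ≤ ((((q * t : ℕ) : ℝ) • D) ∩
        Set.range fun (z : Fin n → ℤ) (i : Fin n) => (z i : ℝ)).ncard := by
  classical
  obtain ⟨c, hc⟩ := h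
  obtain ⟨r, hr, hball⟩ := Metric.isOpen_iff.1 isOpen_interior c hc
  obtain ⟨q, hq⟩ := exists_nat_gt (1 / r)
  have hq0 : (0 : ℝ) < q := (by positivity : (0 : ℝ) < 1 / r).trans hq
  refine ⟨q, by exact_mod_cast hq0, fun t ht hfin => ?_⟩
  have htR : (0 : ℝ) < t := by exact_mod_cast ht
  have hNR : (0 : ℝ) < ((q * t : ℕ) : ℝ) := by push_cast; positivity
  set N : ℝ := ((q * t : ℕ) : ℝ) with hNdef
  let T : Finset (Fin n → ℤ) := Fintype.piFinset fun i => Finset.Ioc ⌊N * c i⌋ (⌊N * c i⌋ + t)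
  have hcard : T.card = t ^ n := by simp [T]
  have hinj : Function.Injective fun (z : Fin n → ℤ) (i : Fin n) => (z i : ℝ) := by
    intro a b hab
    ext i
    exact Int.cast_injective (congrFun hab i)
  rw [← hcard, ← Finset.card_image_of_injective T hinj, ← Set.ncard_coe_finset]
  refine Set.ncard_le_ncard ?_ hfin
  intro x hx
  rw [Finset.mem_coe, Finset.mem_image] at hx
  obtain ⟨z, hz, rfl⟩ := hx
  refine ⟨?_, ⟨z, rfl⟩⟩
  rw [Set.mem_smul_set_iff_inv_smul_mem₀ hNR.ne']
  apply interior_subset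
  apply hball
  rw [Metric.mem_ball, dist_pi_lt_iff hr]
  intro i
  rw [Fintype.mem_piFinset] at hz
  have := Finset.mem_Ioc.1 (hz i)
  have h1 : (⌊N * c i⌋ : ℝ) + 1 ≤ z i := by exact_mod_cast this.1
  have h2 : (z i : ℝ) ≤ ⌊N * c i⌋ + t := by exact_mod_cast this.2
  have h3 := Int.floor_le (N * c i)
  have h4 := Int.lt_floor_add_one (N * c i)
  have h5 : (t : ℝ) < r * N := by
    rw [hNdef]; push_cast
    have : 1 < q * r := by rwa [div_lt_iff₀ hr] at hq
    nlinarith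
  rw [Real.dist_eq, Pi.smul_apply, smul_eq_mul]
  have e : N⁻¹ * (z i : ℝ) - c i = (z i - N * c i) / N := by field_simp
  rw [e, abs_div, abs_of_pos hNR, div_lt_iff₀ hNR, abs_lt]
  constructor <;> linarith

lemma S_eq {k n : ℕ} (w : Fin k → Fin n → ℤ) (N : ℕ) (hN : 0 < N) :
    (((N : ℝ) • convexHull ℝ (Set.range fun (v : Fin k) (i : Fin n) => (w v i : ℝ))) ∩
      Set.range fun (z : Fin n → ℤ) (i : Fin n) => (z i : ℝ)) = S w N := by
  classical
  have hNR : (0 : ℝ) < N := by exact_mod_cast hN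
  have hull : convexHull ℝ (Set.range fun (v : Fin k) (i : Fin n) => (w v i : ℝ)) =
      A w '' stdSimplex ℝ (Fin k) := by
    let L : (Fin k → ℝ) →ₗ[ℝ] (Fin n → ℝ) :=
      { toFun := A w, map_add' := A_add w, map_smul' := A_smul w }
    change _ = L '' _
    rw [← convexHull_basis_eq_stdSimplex, L.image_convexHull, ← Set.range_comp]
    congr 2
    ext v i
    simp [L, A]
  ext x
  rw [hull, Set.mem_inter_iff, Set.mem_smul_set, and_comm]
  refine and_congr ⟨?_, ?_⟩ ⟨?_, ?_⟩
  · rintro ⟨z, rfl⟩; exact ⟨z, fun _ => rfl⟩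
  · rintro ⟨z, hz⟩; exact ⟨z, funext fun i => (hz i).symm⟩
  · rintro ⟨_, ⟨l, ⟨hl, hs⟩, rfl⟩, rfl⟩
    refine ⟨(N : ℝ) • l, fun v => mul_nonneg hNR.le (hl v), A_smul _ _ _, ?_⟩
    simp [← Finset.mul_sum, hs]
  · rintro ⟨l, hl, rfl, hs⟩
    refine ⟨_, ⟨(N : ℝ)⁻¹ • l, ⟨fun v => mul_nonneg (inv_pos.2 hNR).le (hl v), ?_⟩, rfl⟩, ?_⟩
    · simp [← Finset.mul_sum, hs, hNR.ne']
    · rw [A_smul, smul_inv_smul₀ hNR.ne']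

end Ehr

/-- Ehrhart's theorem: if `Δ ⊂ ℝⁿ` is a (full-dimensional) convex
polytope with vertices in `ℤⁿ`, then `N ↦ #((N·Δ) ∩ ℤⁿ)` is a polynomial of degree
`n` in the positive integer `N`. -/
theorem stmt_4 (n : ℕ) (V : Finset (Fin n → ℤ)) (Δ : Set (Fin n → ℝ))
    (hΔ : Δ = convexHull ℝ ((fun (v : Fin n → ℤ) (i : Fin n) => (v i : ℝ)) '' ↑V))
    (hfull : (interior Δ).Nonempty) :
    ∃ p : Polynomial ℚ, p.natDegree = n ∧
      ∀ N : ℕ, 0 < N →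
        ((((N : ℝ) • Δ) ∩ Set.range fun (ℓ : Fin n → ℤ) (i : Fin n) => (ℓ i : ℝ)).ncard : ℚ)
          = p.eval (N : ℚ) := by
  let w : Fin V.card → Fin n → ℤ := fun v => (V.equivFin.symm v : Fin n → ℤ)
  have hrange : ((fun (v : Fin n → ℤ) (i : Fin n) => (v i : ℝ)) '' ↑V) =
      Set.range fun (v : Fin V.card) (i : Fin n) => (w v i : ℝ) := by
    ext x
    constructor
    · rintro ⟨v, hv, rfl⟩
      exact ⟨V.equivFin ⟨v, hv⟩, by simp [w]⟩
    · rintro ⟨v, rfl⟩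
      exact ⟨w v, (V.equivFin.symm v).2, rfl⟩
  rw [hrange] at hΔ
  have hS : ∀ N : ℕ, 0 < N → (((N : ℝ) • Δ) ∩
      Set.range fun (ℓ : Fin n → ℤ) (i : Fin n) => (ℓ i : ℝ)) = Ehr.S w N := by
    intro N hN
    rw [hΔ]
    exact Ehr.S_eq w N hN
  obtain ⟨p, hp⟩ := Ehr.exists_poly w
  obtain ⟨C, hC⟩ := Ehr.upper w
  obtain ⟨q, hq, hlo⟩ := Ehr.lower Δ hfull
  refine ⟨p, Ehr.degree_eq p n C q hq ?_ ?_, fun N hN => by rw [hS N hN, hp N hN]⟩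
  · intro N hN
    rw [← hp N hN]
    exact_mod_cast (hC N hN).2
  · intro t ht
    have hqt : 0 < q * t := Nat.mul_pos hq ht
    have h := hlo t ht
    rw [hS _ hqt] at h
    rw [← hp _ hqt]
    exact_mod_cast h (hC _ hqt).1
end

section
/- Let Δ ⊂ ℝⁿ be a simple polytope described by the inequalities x·uᵢ + aᵢ ≥ 0 for i = 1,…,m, and for h ∈ ℝᵐ and t > 0 let Δ_{t,h} = {x : x·uᵢ + t aᵢ + hᵢ ≥ 0, i=1,…,m}. Then for any polynomial f, the function (t,h) ↦ ∫_{Δ_{t,h}} f(x) dx is a polynomial in t and h, for (t,h) near any point where Δ_{t,h} remains simple with the same combinatorial type. -/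
open MeasureTheory

set_option linter.unusedSectionVars false

namespace PolyInt

open Filter Topology

/-- Polynomial functions on a real vector space. -/
def PolyFn (E : Type) [AddCommGroup E] [Module ℝ E] : Subalgebra ℝ (E → ℝ) :=
  Algebra.adjoin ℝ (Set.range fun (l : E →ₗ[ℝ] ℝ) => (l : E → ℝ))

section alg
variable {E : Type} [AddCommGroup E] [Module ℝ E]

theorem PolyFn.lin (l : E →ₗ[ℝ] ℝ) : (fun x => l x) ∈ PolyFn E :=
  Algebra.subset_adjoin ⟨l, rfl⟩

theorem PolyFn.const (c : ℝ) : (fun _ => c) ∈ PolyFn E :=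
  (PolyFn E).algebraMap_mem c

theorem PolyFn.add {f g : E → ℝ} (hf : f ∈ PolyFn E) (hg : g ∈ PolyFn E) :
    (fun x => f x + g x) ∈ PolyFn E := (PolyFn E).add_mem hf hg

theorem PolyFn.mul {f g : E → ℝ} (hf : f ∈ PolyFn E) (hg : g ∈ PolyFn E) :
    (fun x => f x * g x) ∈ PolyFn E := (PolyFn E).mul_mem hf hg

theorem PolyFn.sum {κ : Type} (s : Finset κ) (f : κ → E → ℝ) (hf : ∀ k ∈ s, f k ∈ PolyFn E) :
    (fun x => ∑ k ∈ s, f k x) ∈ PolyFn E := by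
  have := (PolyFn E).sum_mem hf
  convert this using 1
  ext x; simp

theorem PolyFn.induct {p : (E → ℝ) → Prop} (h1 : ∀ l : E →ₗ[ℝ] ℝ, p (fun x => l x))
    (h2 : ∀ c : ℝ, p (fun _ => c))
    (h3 : ∀ f g, p f → p g → p (fun x => f x + g x))
    (h4 : ∀ f g, p f → p g → p (fun x => f x * g x)) {f : E → ℝ} (hf : f ∈ PolyFn E) : p f := by
  refine Algebra.adjoin_induction (p := fun f _ => p f) ?_ ?_ ?_ ?_ hf
  · rintro _ ⟨l, rfl⟩; exact h1 l
  · exact h2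
  · intro f g _ _; exact h3 f g
  · intro f g _ _; exact h4 f g

/-- affine substitution -/
theorem PolyFn.comp {F : Type} [AddCommGroup F] [Module ℝ F] (L : F →ₗ[ℝ] E) (c : E) {f : E → ℝ}
    (hf : f ∈ PolyFn E) : (fun x => f (L x + c)) ∈ PolyFn F := by
  refine PolyFn.induct (p := fun f => (fun x => f (L x + c)) ∈ PolyFn F) ?_ ?_ ?_ ?_ hf
  · intro l
    simp only [map_add]
    exact PolyFn.add (PolyFn.lin (l ∘ₗ L)) (PolyFn.const _)
  · intro c; exact PolyFn.const _
  · intro f g h1 h2; exact PolyFn.add h1 h2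
  · intro f g h1 h2; exact PolyFn.mul h1 h2

theorem PolyFn.line (v y : E) {f : E → ℝ} (hf : f ∈ PolyFn E) :
    ∃ q : Polynomial ℝ, ∀ s : ℝ, f (s • v + y) = q.eval s := by
  refine PolyFn.induct (p := fun f => ∃ q : Polynomial ℝ, ∀ s : ℝ, f (s • v + y) = q.eval s)
    ?_ ?_ ?_ ?_ hf
  · intro l
    refine ⟨Polynomial.X * Polynomial.C (l v) + Polynomial.C (l y), fun s => ?_⟩
    simp
    ring
  · intro c; exact ⟨Polynomial.C c, by simp⟩
  · rintro f g ⟨p, hp⟩ ⟨q, hq⟩; exact ⟨p + q, by simp [hp, hq]⟩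
  · rintro f g ⟨p, hp⟩ ⟨q, hq⟩; exact ⟨p * q, by simp [hp, hq]⟩

/-- The substitution used for cones. -/
theorem PolyFn.coneExpand {K B : Type} [AddCommGroup K] [Module ℝ K] [AddCommGroup B] [Module ℝ B]
    (j : K →ₗ[ℝ] E) (β : B →ₗ[ℝ] ℝ) (w : E) {f : E → ℝ} (hf : f ∈ PolyFn E) :
    ∃ (κ : Type) (_ : Fintype κ) (p : κ → ℝ → ℝ) (q : κ → B → ℝ) (t : κ → K → ℝ),
      (∀ k, Continuous (p k)) ∧ (∀ k, q k ∈ PolyFn B) ∧ (∀ k, t k ∈ PolyFn K) ∧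
      ∀ r b z, f ((-(β b) * r) • w + r • j z) = ∑ k, p k r * (q k b * t k z) := by
  refine PolyFn.induct (p := fun f => ∃ (κ : Type) (_ : Fintype κ) (p : κ → ℝ → ℝ)
    (q : κ → B → ℝ) (t : κ → K → ℝ),
      (∀ k, Continuous (p k)) ∧ (∀ k, q k ∈ PolyFn B) ∧ (∀ k, t k ∈ PolyFn K) ∧
      ∀ r b z, f ((-(β b) * r) • w + r • j z) = ∑ k, p k r * (q k b * t k z)) ?_ ?_ ?_ ?_ hf
  · intro l
    refine ⟨Unit ⊕ Unit, inferInstance, fun _ r => r,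
      Sum.elim (fun _ b => β b * (- l w)) (fun _ _ => 1),
      Sum.elim (fun _ _ => 1) (fun _ z => l (j z)), fun _ => continuous_id, ?_, ?_, ?_⟩
    · rintro (_ | _)
      · exact PolyFn.mul (PolyFn.lin β) (PolyFn.const _)
      · exact PolyFn.const _
    · rintro (_ | _)
      · exact PolyFn.const _
      · exact PolyFn.lin (l ∘ₗ j)
    · intro r b z
      simp
      ring
  · intro c
    exact ⟨Unit, inferInstance, fun _ _ => c, fun _ _ => 1, fun _ _ => 1,
      fun _ => continuous_const, fun _ => PolyFn.const _, fun _ => PolyFn.const _, by simp⟩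
  · rintro f g ⟨κ, _, p, q, t, hp, hq, ht, h⟩ ⟨κ', _, p', q', t', hp', hq', ht', h'⟩
    refine ⟨κ ⊕ κ', inferInstance, Sum.elim p p', Sum.elim q q', Sum.elim t t', ?_, ?_, ?_, ?_⟩
    · rintro (k | k); exacts [hp k, hp' k]
    · rintro (k | k); exacts [hq k, hq' k]
    · rintro (k | k); exacts [ht k, ht' k]
    · intro r b z; simp only [h, h', Fintype.sum_sum_type, Sum.elim_inl, Sum.elim_inr]
  · rintro f g ⟨κ, _, p, q, t, hp, hq, ht, h⟩ ⟨κ', _, p', q', t', hp', hq', ht', h'⟩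
    refine ⟨κ × κ', inferInstance, fun k r => p k.1 r * p' k.2 r,
      fun k r => q k.1 r * q' k.2 r, fun k r => t k.1 r * t' k.2 r, ?_, ?_, ?_, ?_⟩
    · intro k; exact (hp _).mul (hp' _)
    · intro k; exact PolyFn.mul (hq _) (hq' _)
    · intro k; exact PolyFn.mul (ht _) (ht' _)
    · intro r b z
      simp only [h, h']
      rw [Finset.sum_mul_sum, Fintype.sum_prod_type]
      refine Finset.sum_congr rfl fun a _ => Finset.sum_congr rfl fun c _ => ?_
      ring

end alg

section meas
variable {E : Type} [NormedAddCommGroup E] [NormedSpace ℝ E] [FiniteDimensional ℝ E]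

theorem PolyFn.cont {f : E → ℝ} (hf : f ∈ PolyFn E) : Continuous f := by
  refine PolyFn.induct (p := fun f => Continuous f) ?_ ?_ ?_ ?_ hf
  · intro l; exact l.continuous_of_finiteDimensional
  · intro c; exact continuous_const
  · intro f g; exact Continuous.add
  · intro f g; exact Continuous.mul

/-- splitting along a hyperplane -/
def splitL (l : E →ₗ[ℝ] ℝ) (w : E) (hw : l w = 1) : (ℝ × LinearMap.ker l) ≃ₗ[ℝ] E where
  toFun p := p.1 • w + (p.2 : E)
  map_add' p q := by simp [add_smul]; abel
  map_smul' c p := by simp [mul_smul]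
  invFun x := (l x, ⟨x - l x • w, by simp [hw]⟩)
  left_inv p := by
    have : l (p.2 : E) = 0 := p.2.2
    ext <;> simp [hw, this]
  right_inv x := by simp

variable [MeasurableSpace E] [BorelSpace E]

theorem split (μ : Measure E) [μ.IsAddHaarMeasure] (l : E →ₗ[ℝ] ℝ) (w : E) (hw : l w = 1) :
    ∃ (c : ℝ), ∀ G : E → ℝ,
      (∫ x, G x ∂μ = c * ∫ p : ℝ × LinearMap.ker l, G (p.1 • w + (p.2 : E))
        ∂((volume : Measure ℝ).prod (Measure.addHaar : Measure (LinearMap.ker l)))) ∧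
      (Integrable G μ → Integrable (fun p : ℝ × LinearMap.ker l => G (p.1 • w + (p.2 : E)))
        ((volume : Measure ℝ).prod (Measure.addHaar : Measure (LinearMap.ker l)))) := by
  let e : (ℝ × LinearMap.ker l) ≃L[ℝ] E := (splitL l w hw).toContinuousLinearEquiv
  let ρ := (volume : Measure ℝ).prod (Measure.addHaar : Measure (LinearMap.ker l))
  have he : ∀ p, e p = p.1 • w + (p.2 : E) := fun p => rfl
  have hH : (Measure.map e ρ).IsAddHaarMeasure := e.isAddHaarMeasure_map ρ
  let em := e.toHomeomorph.toMeasurableEquiv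
  have hem : ∀ p, em p = p.1 • w + (p.2 : E) := fun p => rfl
  refine ⟨(μ.addHaarScalarFactor (Measure.map e ρ) : ℝ), fun G => ⟨?_, fun hG => ?_⟩⟩
  · conv_lhs => rw [Measure.isAddLeftInvariant_eq_smul μ (Measure.map e ρ)]
    rw [integral_smul_nnreal_measure]
    change _ • (∫ x, G x ∂(Measure.map em ρ)) = _
    rw [integral_map_equiv]
    rfl
  · have h2 : Integrable G (Measure.map em ρ) := by
      change Integrable G (Measure.map e ρ)
      rw [Measure.isAddLeftInvariant_eq_smul (Measure.map e ρ) μ]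
      exact hG.smul_measure_nnreal
    rw [integrable_map_equiv] at h2
    exact h2

/-- A one-variable polynomial integrated over a set containing a half line: always `0`. -/
theorem integral_halfline (S : Set ℝ) (hS : MeasurableSet S) (hup : ∀ s ∈ S, ∀ r, 0 ≤ r → s + r ∈ S)
    (q : Polynomial ℝ) : ∫ s, S.indicator (fun s => q.eval s) s = 0 := by
  by_contra hne
  have hIntegr : Integrable (S.indicator (fun s => q.eval s)) := by
    by_contra h; exact hne (integral_undef h)
  have hSne : S.Nonempty := by
    by_contra h
    rw [Set.not_nonempty_iff_eq_empty] at h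
    simp [h] at hne
  obtain ⟨s0, hs0⟩ := hSne
  rw [integrable_indicator_iff hS] at hIntegr
  have hq : q ≠ 0 := by rintro rfl; simp at hne
  have hc : ∃ c > 0, ∀ᶠ s in atTop, c ≤ |q.eval s| := by
    by_cases hd : 0 < q.degree
    · exact ⟨1, one_pos, (q.abs_tendsto_atTop hd).eventually_ge_atTop 1⟩
    · rw [not_lt] at hd
      rw [Polynomial.eq_C_of_degree_le_zero hd] at hq ⊢
      refine ⟨|q.coeff 0|, ?_, by simp⟩
      rw [gt_iff_lt, abs_pos]
      intro h; simp [h] at hq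
  obtain ⟨c, hc0, hc⟩ := hc
  obtain ⟨M, hM⟩ := eventually_atTop.1 hc
  have h1 : IntegrableOn (fun s => q.eval s) (Set.Ici (max s0 M)) := by
    refine hIntegr.mono_set fun x hx => ?_
    have := hup s0 hs0 (x - s0) (by have := le_trans (le_max_left _ _) (Set.mem_Ici.1 hx); linarith)
    simpa using this
  have h2 : IntegrableOn (fun _ => c) (Set.Ici (max s0 M)) := by
    refine Integrable.mono h1 (by fun_prop) ?_
    refine (ae_restrict_iff' measurableSet_Ici).2 (Eventually.of_forall fun x hx => ?_)
    rw [Real.norm_of_nonneg hc0.le]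
    exact hM x (le_trans (le_max_right _ _) hx)
  rw [integrableOn_const_iff] at h2
  simp [hc0.ne'] at h2

variable {ι : Type} [Fintype ι]

def polyh (u : ι → E →ₗ[ℝ] ℝ) (b : ι → ℝ) : Set E := {x | ∀ i, 0 ≤ u i x + b i}

theorem polyh_closed (u : ι → E →ₗ[ℝ] ℝ) (b : ι → ℝ) : IsClosed (polyh u b) := by
  have : polyh u b = ⋂ i, {x | 0 ≤ u i x + b i} := by ext; simp [polyh]
  rw [this]
  refine isClosed_iInter fun i => isClosed_le continuous_const ?_
  exact ((u i).continuous_of_finiteDimensional).add continuous_const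

theorem unbdd (μ : Measure E) [μ.IsAddHaarMeasure] (u : ι → E →ₗ[ℝ] ℝ) (b : ι → ℝ)
    (v : E) (hv : v ≠ 0) (huv : ∀ i, 0 ≤ u i v) {f : E → ℝ} (hf : f ∈ PolyFn E) :
    ∫ x in polyh u b, f x ∂μ = 0 := by
  obtain ⟨l, hl⟩ := SeparatingDual.exists_eq_one (R := ℝ) hv
  obtain ⟨c, hc⟩ := split μ (l : E →ₗ[ℝ] ℝ) v hl
  have hm := (polyh_closed u b).measurableSet
  rw [← integral_indicator hm, (hc _).1]
  by_cases hI : Integrable (fun p : ℝ × LinearMap.ker (l : E →ₗ[ℝ] ℝ) =>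
      (polyh u b).indicator f (p.1 • v + (p.2 : E)))
        ((volume : Measure ℝ).prod (Measure.addHaar : Measure (LinearMap.ker (l : E →ₗ[ℝ] ℝ))))
  · rw [integral_prod_symm _ hI]
    suffices ∀ y : LinearMap.ker (l : E →ₗ[ℝ] ℝ),
        ∫ s : ℝ, (polyh u b).indicator f (s • v + (y : E)) = 0 by simp [this]
    intro y
    obtain ⟨q, hq⟩ := PolyFn.line v (y : E) hf
    have := integral_halfline ((fun s : ℝ => s • v + (y : E)) ⁻¹' polyh u b)
      (((polyh_closed u b).preimage (by fun_prop)).measurableSet) ?_ q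
    · rw [← this]
      congr 1; ext s
      simp only [Set.indicator, hq]
      rfl
    · intro s hs r hr i
      have h1 := hs i
      have h2 := mul_nonneg hr (huv i)
      simp only [map_add, map_smul, smul_eq_mul] at h1 ⊢
      linarith
  · rw [integral_undef hI, mul_zero]

theorem bdd (u : ι → E →ₗ[ℝ] ℝ) (hu : ∀ v, (∀ i, 0 ≤ u i v) → v = 0) (b : ι → ℝ) :
    IsCompact (polyh u b) := by
  refine Metric.isCompact_of_isClosed_isBounded (polyh_closed u b) ?_
  have hcu : ∀ i, Continuous (u i) := fun i => (u i).continuous_of_finiteDimensional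
  by_cases hE : (Metric.sphere (0 : E) 1).Nonempty
  · -- penalty function
    let g : E → ℝ := fun x => ∑ i, max 0 (-(u i x))
    have hg : Continuous g := continuous_finsetSum _ fun i _ =>
      continuous_const.max (hcu i).neg
    obtain ⟨x0, hx0, hmin⟩ := (isCompact_sphere (0 : E) 1).exists_isMinOn hE hg.continuousOn
    have hpos : 0 < g x0 := by
      have h0 : 0 ≤ g x0 := Finset.sum_nonneg fun i _ => le_max_left _ _
      refine lt_of_le_of_ne h0 fun h => ?_
      have h1 := (Finset.sum_eq_zero_iff_of_nonneg (fun i _ => le_max_left _ _)).1 h.symm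
      have : x0 = 0 := hu x0 fun i => by
        have := le_max_right 0 (-(u i x0))
        rw [h1 i (Finset.mem_univ i)] at this
        linarith
      simp [this] at hx0
    rw [isBounded_iff_forall_norm_le]
    refine ⟨(∑ i, |b i|) / g x0, fun x hx => ?_⟩
    rw [le_div_iff₀ hpos]
    by_cases hx0' : x = 0
    · simp [hx0']; exact Finset.sum_nonneg fun i _ => abs_nonneg _
    have hn : 0 < ‖x‖ := norm_pos_iff.2 hx0'
    have h1 : g x0 ≤ g (‖x‖⁻¹ • x) := hmin (by simp [norm_smul, hn.ne'])
    have h2 : ‖x‖ * g (‖x‖⁻¹ • x) = g x := by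
      simp only [g, Finset.mul_sum]
      refine Finset.sum_congr rfl fun i _ => ?_
      rw [mul_max_of_nonneg _ _ hn.le]
      simp [hn.ne']
    have h3 : g x ≤ ∑ i, |b i| := by
      refine Finset.sum_le_sum fun i _ => max_le (abs_nonneg _) ?_
      have := hx i
      have := le_abs_self (b i)
      linarith
    calc ‖x‖ * g x0 ≤ ‖x‖ * g (‖x‖⁻¹ • x) := by gcongr
      _ = g x := h2
      _ ≤ _ := h3
  · rw [isBounded_iff_forall_norm_le]
    refine ⟨0, fun x _ => ?_⟩
    by_contra hx
    rw [not_le] at hx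
    exact hE ⟨‖x‖⁻¹ • x, by simp [norm_smul, hx.ne']⟩

end meas

section cone
variable {E : Type} [NormedAddCommGroup E] [NormedSpace ℝ E] [FiniteDimensional ℝ E]
variable {ι : Type} [Fintype ι]

/-- simplicity and constancy of the combinatorial type near `b0` -/
def Good (u : ι → E →ₗ[ℝ] ℝ) (b0 : ι → ℝ) : Prop :=
  ∃ V ∈ 𝓝 b0, (∀ b ∈ V, ∀ x ∈ polyh u b, ∀ β : ι → ℝ, ∃ v, ∀ j, u j x + b j = 0 → u j v = β j) ∧
    (∀ b ∈ V, ∀ b' ∈ V, ∀ I : Finset ι, (∃ x ∈ polyh u b, ∀ i ∈ I, u i x + b i = 0) →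
      ∃ x ∈ polyh u b', ∀ i ∈ I, u i x + b' i = 0)

def coneSet (u : ι → E →ₗ[ℝ] ℝ) (b : ι → ℝ) (i : ι) : Set E :=
  {x | u i x < 0 ∧ 0 ≤ u i x + b i ∧ ∀ j, b j * u i x ≤ b i * u j x}

def facU (u : ι → E →ₗ[ℝ] ℝ) (i : ι) (j : {j // j ≠ i}) : LinearMap.ker (u i) →ₗ[ℝ] ℝ :=
  u j ∘ₗ (LinearMap.ker (u i)).subtype

def facB (u : ι → E →ₗ[ℝ] ℝ) (i : ι) (w : E) : (ι → ℝ) →ₗ[ℝ] ({j // j ≠ i} → ℝ) where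
  toFun b j := b j - u j w * b i
  map_add' b c := by ext; simp; ring
  map_smul' b c := by ext; simp; ring

variable [MeasurableSpace E] [BorelSpace E]

theorem coneSet_meas (u : ι → E →ₗ[ℝ] ℝ) (b : ι → ℝ) (i : ι) :
    MeasurableSet (coneSet u b i) := by
  have hcu : ∀ i, Measurable (u i) := fun i => (u i).continuous_of_finiteDimensional.measurable
  refine (measurableSet_lt (hcu i) measurable_const).inter
    ((measurableSet_le measurable_const ((hcu i).add_const _)).inter ?_)
  change MeasurableSet {x | ∀ j, b j * u i x ≤ b i * u j x}
  rw [Set.ofPred_forall]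
  exact MeasurableSet.iInter fun j =>
    measurableSet_le ((hcu i).const_mul _) ((hcu j).const_mul _)

theorem coneSet_sub (u : ι → E →ₗ[ℝ] ℝ) (b : ι → ℝ) (hb : ∀ i, 0 < b i) (i : ι) :
    coneSet u b i ⊆ polyh u b := by
  rintro x ⟨h1, h2, h3⟩ j
  have h4 : b i * (u j x + b j) ≥ 0 := by
    have := mul_nonneg (hb j).le h2
    have := h3 j
    nlinarith
  exact nonneg_of_mul_nonneg_right h4 (hb i)

theorem cone_formula (u : ι → E →ₗ[ℝ] ℝ) (hu : ∀ v, (∀ i, 0 ≤ u i v) → v = 0) (i : ι) (w : E)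
    (hw : u i w = 1)
    (hu' : ∀ v, (∀ j, 0 ≤ facU u i j v) → v = 0)
    (μ : Measure E) [μ.IsAddHaarMeasure] (c : ℝ)
    (hc : ∀ G : E → ℝ,
      (∫ x, G x ∂μ = c * ∫ p : ℝ × LinearMap.ker (u i), G (p.1 • w + (p.2 : E))
        ∂((volume : Measure ℝ).prod (Measure.addHaar : Measure (LinearMap.ker (u i))))) ∧
      (Integrable G μ → Integrable (fun p : ℝ × LinearMap.ker (u i) => G (p.1 • w + (p.2 : E)))
        ((volume : Measure ℝ).prod (Measure.addHaar : Measure (LinearMap.ker (u i))))))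
    {f : E → ℝ} (hf : f ∈ PolyFn E) (b : ι → ℝ) (hb : ∀ i, 0 < b i)
    (κ : Type) [Fintype κ] (p : κ → ℝ → ℝ) (q : κ → ℝ)
    (t : κ → LinearMap.ker (u i) → ℝ) (hp : ∀ k, Continuous (p k))
    (ht : ∀ k, t k ∈ PolyFn (LinearMap.ker (u i)))
    (hexp : ∀ r (z : LinearMap.ker (u i)),
      f ((-(b i) * r) • w + r • (z : E)) = ∑ k, p k r * (q k * t k z)) :
    ∫ x in coneSet u b i, f x ∂μ = c * (b i *
      ∑ k, (∫ r in Set.Ioc (0 : ℝ) 1, r ^ Module.finrank ℝ (LinearMap.ker (u i)) * p k r) *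
        (q k * ∫ z in polyh (facU u i) (facB u i w b), t k z ∂Measure.addHaar)) := by
  classical
  have hcm := coneSet_meas u b i
  have hIntegr : Integrable ((coneSet u b i).indicator f) μ := by
    rw [integrable_indicator_iff hcm]
    exact (((PolyFn.cont hf).continuousOn).integrableOn_compact (bdd u hu b)).mono_set
      (coneSet_sub u b hb i)
  rw [← integral_indicator hcm, (hc _).1, integral_prod _ ((hc _).2 hIntegr)]
  congr 1
  set G := (coneSet u b i).indicator f with hG
  set d := Module.finrank ℝ (LinearMap.ker (u i)) with hd
  have hbi := hb i
  have h1 := Measure.integral_comp_mul_left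
    (fun s : ℝ => ∫ y : LinearMap.ker (u i), G (s • w + (y : E)) ∂Measure.addHaar) (-(b i))
  have h2 : (∫ s : ℝ, ∫ y : LinearMap.ker (u i), G (s • w + (y : E)) ∂Measure.addHaar) =
      b i * ∫ r : ℝ, ∫ y : LinearMap.ker (u i), G ((-(b i) * r) • w + (y : E))
        ∂Measure.addHaar := by
    rw [h1, smul_eq_mul, abs_inv, abs_neg, abs_of_pos hbi, mul_inv_cancel_left₀ hbi.ne']
  refine h2.trans ?_
  congr 1
  have hcomp := bdd (facU u i) hu' (facB u i w b)
  have htint : ∀ k, IntegrableOn (t k) (polyh (facU u i) (facB u i w b)) Measure.addHaar :=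
    fun k => (PolyFn.cont (ht k)).continuousOn.integrableOn_compact hcomp
  have key : ∀ r : ℝ, (∫ y : LinearMap.ker (u i), G ((-(b i) * r) • w + (y : E))
        ∂Measure.addHaar) = (Set.Ioc (0 : ℝ) 1).indicator (fun r => ∑ k, (r ^ d * p k r) *
        (q k * ∫ z in polyh (facU u i) (facB u i w b), t k z ∂Measure.addHaar)) r := by
    intro r
    by_cases hr : r ∈ Set.Ioc (0 : ℝ) 1
    · rw [Set.indicator_of_mem hr]
      have hr0 := hr.1
      have h3 := Measure.integral_comp_smul (Measure.addHaar : Measure (LinearMap.ker (u i)))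
        (fun y : LinearMap.ker (u i) => G ((-(b i) * r) • w + (y : E))) r
      have hrd : 0 < r ^ d := pow_pos hr0 d
      have h4 : (∫ y : LinearMap.ker (u i), G ((-(b i) * r) • w + (y : E))
        ∂Measure.addHaar) = r ^ d * ∫ z : LinearMap.ker (u i),
          G ((-(b i) * r) • w + ((r • z : LinearMap.ker (u i)) : E)) ∂Measure.addHaar := by
        rw [h3, smul_eq_mul, abs_inv, abs_of_pos hrd, mul_inv_cancel_left₀ hrd.ne']
      rw [h4]
      have h5 : (fun z : LinearMap.ker (u i) =>
          G ((-(b i) * r) • w + ((r • z : LinearMap.ker (u i)) : E))) =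
          (polyh (facU u i) (facB u i w b)).indicator
            (fun z => ∑ k, p k r * (q k * t k z)) := by
        ext z
        have hz : u i (z : E) = 0 := z.2
        have hiff : ((-(b i) * r) • w + ((r • z : LinearMap.ker (u i)) : E)) ∈ coneSet u b i ↔
            z ∈ polyh (facU u i) (facB u i w b) := by
          simp only [coneSet, polyh, Set.mem_ofPred_eq, facU, facB, map_add, map_smul, hw,
            smul_eq_mul, Submodule.coe_smul, hz, LinearMap.comp_apply, Submodule.subtype_apply,
            LinearMap.coe_mk, AddHom.coe_mk]
          constructor
          · rintro ⟨-, -, h⟩ j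
            have := h j
            have h6 : 0 ≤ (b i * r) * (u j (z : E) + (b j - u j w * b i)) := by
              ring_nf at this ⊢; linarith
            exact nonneg_of_mul_nonneg_right h6 (mul_pos hbi hr0)
          · intro h
            refine ⟨by nlinarith, by nlinarith [hr.2], fun j => ?_⟩
            by_cases hj : j = i
            · subst hj; simp [hz, hw]
            · have := mul_nonneg (mul_pos hbi hr0).le (h ⟨j, hj⟩)
              ring_nf at this ⊢; linarith
        by_cases hzz : z ∈ polyh (facU u i) (facB u i w b)
        · rw [Set.indicator_of_mem hzz, hG, Set.indicator_of_mem (hiff.2 hzz), ← hexp]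
          rfl
        · rw [Set.indicator_of_notMem hzz, hG, Set.indicator_of_notMem (fun h => hzz (hiff.1 h))]
      rw [h5, integral_indicator (polyh_closed _ _).measurableSet, integral_finsetSum _
        (fun k _ => ((htint k).const_mul _).const_mul _), Finset.mul_sum]
      refine Finset.sum_congr rfl fun k _ => ?_
      rw [integral_const_mul, integral_const_mul]
      ring
    · rw [Set.indicator_of_notMem hr]
      have : ∀ y : LinearMap.ker (u i), G ((-(b i) * r) • w + (y : E)) = 0 := by
        intro y
        refine Set.indicator_of_notMem (fun h => hr ?_) _
        have hy : u i (y : E) = 0 := y.2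
        obtain ⟨h1, h2, -⟩ := h
        simp only [map_add, map_smul, hw, hy, smul_eq_mul] at h1 h2
        constructor
        · by_contra hh; nlinarith
        · by_contra hh; nlinarith
      simp_rw [this]
      simp
  simp_rw [key]
  rw [integral_indicator measurableSet_Ioc, integral_finsetSum]
  · refine Finset.sum_congr rfl fun k _ => ?_
    rw [integral_mul_const]
  · intro k _
    refine Integrable.mul_const ?_ _
    have : Continuous fun r : ℝ => r ^ d * p k r := (continuous_pow d).mul (hp k)
    exact (this.integrableOn_Icc (a := 0) (b := 1)).mono_set Set.Ioc_subset_Icc_self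

end cone

section main
variable (E : Type) [NormedAddCommGroup E] [NormedSpace ℝ E] [FiniteDimensional ℝ E]
variable [MeasurableSpace E] [BorelSpace E]

def Claim : Prop :=
  ∀ (μ : Measure E) [μ.IsAddHaarMeasure] (ι : Type) [Fintype ι] (u : ι → E →ₗ[ℝ] ℝ) (b0 : ι → ℝ),
    (∀ v, (∀ i, 0 ≤ u i v) → v = 0) → Good u b0 → ∀ f ∈ PolyFn E,
    ∃ g ∈ PolyFn (ι → ℝ), ∀ᶠ b in 𝓝 b0, ∫ x in polyh u b, f x ∂μ = g b

variable {E}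
variable {ι : Type} [Fintype ι]

theorem Good.fac {u : ι → E →ₗ[ℝ] ℝ} {b0 : ι → ℝ} (hg : Good u b0) (i : ι) (w : E)
    (hw : u i w = 1) : Good (facU u i) (facB u i w b0) := by
  classical
  obtain ⟨V, hV, hs, hcb⟩ := hg
  let lift : ({j // j ≠ i} → ℝ) → (ι → ℝ) := fun b' j =>
    if h : j = i then b0 i else b' ⟨j, h⟩ + u j w * b0 i
  have hlc : Continuous lift := by
    refine continuous_pi fun j => ?_
    by_cases h : j = i
    · simp only [lift, h, dite_true]; exact continuous_const
    · simp only [lift, h, dite_false]; fun_prop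
  have hl0 : lift (facB u i w b0) = b0 := by
    ext j
    by_cases h : j = i
    · simp [lift, h]
    · simp [lift, h, facB]
  have hli : ∀ b', lift b' i = b0 i := fun b' => by simp [lift]
  have hlj : ∀ b' (j : {j // j ≠ i}), lift b' j = b' j + u j w * b0 i := fun b' j => by
    simp [lift, j.2]
  -- points of the facet
  have hpt : ∀ b' (y : LinearMap.ker (u i)) (j : {j // j ≠ i}),
      u j (-(b0 i) • w + (y : E)) + lift b' j = facU u i j y + b' j := by
    intro b' y j
    rw [hlj]
    simp [facU]
    ring
  have hpi : ∀ b' (y : LinearMap.ker (u i)), u i (-(b0 i) • w + (y : E)) + lift b' i = 0 := by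
    intro b' y
    have hy : u i (y : E) = 0 := y.2
    rw [hli]; simp [hw, hy]
  have hmem : ∀ b' (y : LinearMap.ker (u i)), y ∈ polyh (facU u i) b' ↔
      (-(b0 i) • w + (y : E)) ∈ polyh u (lift b') := by
    intro b' y
    constructor
    · intro h j
      by_cases hj : j = i
      · subst hj; rw [hpi]
      · have := h ⟨j, hj⟩
        rw [← hpt] at this; exact this
    · intro h j
      rw [← hpt]; exact h j
  refine ⟨lift ⁻¹' V, hlc.continuousAt.preimage_mem_nhds (by rwa [hl0]), ?_, ?_⟩
  · intro b' hb' y hy β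
    obtain ⟨v, hv⟩ := hs (lift b') hb' _ ((hmem b' y).1 hy)
      (fun j => if h : j = i then 0 else β ⟨j, h⟩)
    refine ⟨⟨v, ?_⟩, fun j hj => ?_⟩
    · have := hv i (hpi b' y)
      simpa using this
    · rw [← hpt] at hj
      have := hv j hj
      simp only [j.2, dite_false] at this
      exact this
  · intro b hb b' hb' I ⟨y, hy, hyI⟩
    obtain ⟨x, hx, hxI⟩ := hcb (lift b) hb (lift b') hb' (insert i (I.map (Function.Embedding.subtype _)))
      ⟨_, (hmem b y).1 hy, by
        intro j hj
        rw [Finset.mem_insert, Finset.mem_map] at hj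
        rcases hj with rfl | ⟨j, hj, rfl⟩
        · exact hpi b y
        · exact (hpt b y j).trans (hyI j hj)⟩
    have hxi := hxI i (Finset.mem_insert_self _ _)
    rw [hli] at hxi
    let z : LinearMap.ker (u i) := ⟨x + b0 i • w, by simp [hw, hxi]⟩
    have hz : -(b0 i) • w + (z : E) = x := by simp [z]
    refine ⟨z, (hmem b' z).2 (by rwa [hz]), fun j hj => ?_⟩
    rw [← hpt, hz]
    exact hxI j (Finset.mem_insert_of_mem (Finset.mem_map_of_mem _ hj))

theorem rec_fac {u : ι → E →ₗ[ℝ] ℝ} (hu : ∀ v, (∀ i, 0 ≤ u i v) → v = 0) (i : ι)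
    (v : LinearMap.ker (u i)) (hv : ∀ j, 0 ≤ facU u i j v) : v = 0 := by
  have : (v : E) = 0 := hu v fun j => by
    by_cases hj : j = i
    · subst hj; exact le_of_eq (v.2 : u j (v : E) = 0).symm
    · exact hv ⟨j, hj⟩
  exact_mod_cast this

theorem cone_poly (IH : ∀ l : E →ₗ[ℝ] ℝ, l ≠ 0 → Claim (LinearMap.ker l))
    (μ : Measure E) [μ.IsAddHaarMeasure] (u : ι → E →ₗ[ℝ] ℝ) (b0 : ι → ℝ)
    (hu : ∀ v, (∀ i, 0 ≤ u i v) → v = 0) (hg : Good u b0) (hb0 : ∀ i, 0 < b0 i)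
    {f : E → ℝ} (hf : f ∈ PolyFn E) (i : ι) :
    ∃ g ∈ PolyFn (ι → ℝ), ∀ᶠ b in 𝓝 b0, ∫ x in coneSet u b i, f x ∂μ = g b := by
  classical
  by_cases hui : u i = 0
  · refine ⟨fun _ => 0, PolyFn.const 0, Eventually.of_forall fun b => ?_⟩
    have : coneSet u b i = ∅ := by
      ext x; simp [coneSet, hui]
    simp [this]
  obtain ⟨w0, hw0⟩ : ∃ w0, u i w0 ≠ 0 := by
    by_contra! h; exact hui (LinearMap.ext h)
  let w := (u i w0)⁻¹ • w0
  have hw : u i w = 1 := by simp [w, hw0]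
  obtain ⟨c, hc⟩ := split μ (u i) w hw
  obtain ⟨κ, _, p, q, t, hp, hq, ht, hexp⟩ :=
    PolyFn.coneExpand (LinearMap.ker (u i)).subtype (LinearMap.proj i : (ι → ℝ) →ₗ[ℝ] ℝ) w hf
  have hIH := fun k => IH (u i) hui Measure.addHaar {j // j ≠ i} (facU u i) (facB u i w b0)
    (rec_fac hu i) (hg.fac i w hw) (t k) (ht k)
  choose g hgP hgE using hIH
  refine ⟨fun b => c * (b i *
      ∑ k, (∫ r in Set.Ioc (0 : ℝ) 1, r ^ Module.finrank ℝ (LinearMap.ker (u i)) * p k r) *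
        (q k b * g k (facB u i w b))), ?_, ?_⟩
  · refine PolyFn.mul (PolyFn.const c) (PolyFn.mul (PolyFn.lin (LinearMap.proj i : (ι → ℝ) →ₗ[ℝ] ℝ)) ?_)
    refine PolyFn.sum _ _ fun k _ => PolyFn.mul (PolyFn.const _) (PolyFn.mul (hq k) ?_)
    have := PolyFn.comp (facB u i w) 0 (hgP k)
    simpa using this
  · have hfc : Continuous (facB u i w) := (facB u i w).continuous_of_finiteDimensional
    have h1 : ∀ᶠ b in 𝓝 b0, ∀ k, ∫ x in polyh (facU u i) (facB u i w b), t k x ∂Measure.addHaar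
        = g k (facB u i w b) :=
      eventually_all.2 fun k => hfc.continuousAt.eventually (hgE k)
    have h2 : ∀ᶠ b in 𝓝 b0, ∀ j, 0 < b j := eventually_all.2 fun j =>
      (continuous_apply j).continuousAt.eventually (lt_mem_nhds (hb0 j))
    filter_upwards [h1, h2] with b hb1 hb2
    rw [cone_formula u hu i w hw (rec_fac hu i) μ c hc hf b hb2 κ p (fun k => q k b) t hp ht
      (fun r z => hexp r b z)]
    simp only [hb1]

theorem pos_case (hE : 0 < Module.finrank ℝ E)
    (IH : ∀ l : E →ₗ[ℝ] ℝ, l ≠ 0 → Claim (LinearMap.ker l))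
    (μ : Measure E) [μ.IsAddHaarMeasure] (u : ι → E →ₗ[ℝ] ℝ) (b0 : ι → ℝ)
    (hu : ∀ v, (∀ i, 0 ≤ u i v) → v = 0) (hg : Good u b0) (hb0 : ∀ i, 0 < b0 i)
    {f : E → ℝ} (hf : f ∈ PolyFn E) :
    ∃ g ∈ PolyFn (ι → ℝ), ∀ᶠ b in 𝓝 b0, ∫ x in polyh u b, f x ∂μ = g b := by
  classical
  choose g hgP hgE using fun i => cone_poly IH μ u b0 hu hg hb0 hf i
  refine ⟨fun b => ∑ i, g i b, PolyFn.sum _ _ fun i _ => hgP i, ?_⟩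
  obtain ⟨V, hV, hs, -⟩ := hg
  have h2 : ∀ᶠ b in 𝓝 b0, ∀ j, 0 < b j := eventually_all.2 fun j =>
    (continuous_apply j).continuousAt.eventually (lt_mem_nhds (hb0 j))
  have hnt : Nontrivial E := Module.finrank_pos_iff.1 hE
  filter_upwards [eventually_all.2 hgE, h2, hV] with b hb1 hb2 hbV
  have hzero : μ {(0 : E)} = 0 := by
    have := Measure.addHaar_submodule μ (⊥ : Submodule ℝ E) bot_ne_top
    rwa [Submodule.bot_coe] at this
  have hun : (⋃ i, coneSet u b i) = polyh u b \ {0} := by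
    ext x
    simp only [Set.mem_iUnion, Set.mem_sdiff, Set.mem_singleton_iff]
    constructor
    · rintro ⟨i, hi⟩
      refine ⟨coneSet_sub u b hb2 i hi, ?_⟩
      rintro rfl
      have := hi.1
      simp at this
    · rintro ⟨hx, hx0⟩
      have : ∃ i, u i x < 0 := by
        by_contra! h; exact hx0 (hu x h)
      obtain ⟨i0, hi0⟩ := this
      obtain ⟨i, -, hi⟩ := Finset.exists_min_image Finset.univ (fun i => u i x / b i)
        ⟨i0, Finset.mem_univ _⟩
      refine ⟨i, ?_, hx i, fun j => ?_⟩
      · have h1 := hi i0 (Finset.mem_univ _)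
        have h3 : u i0 x / b i0 < 0 := div_neg_of_neg_of_pos hi0 (hb2 i0)
        by_contra! h4
        have := div_nonneg h4 (hb2 i).le
        linarith
      · have h1 := hi j (Finset.mem_univ _)
        rw [div_le_div_iff₀ (hb2 i) (hb2 j)] at h1
        linarith
  have hdisj : Pairwise (Function.onFun (AEDisjoint μ) (coneSet u b)) := by
    intro i j hij
    let l : E →ₗ[ℝ] ℝ := b j • u i - b i • u j
    have hsub : coneSet u b i ∩ coneSet u b j ⊆ (LinearMap.ker l : Set E) := by
      rintro x ⟨h1, h2⟩
      have h3 := h1.2.2 j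
      have h4 := h2.2.2 i
      simp only [SetLike.mem_coe, LinearMap.mem_ker, l, LinearMap.sub_apply, LinearMap.smul_apply,
        smul_eq_mul]
      linarith
    by_cases hl : LinearMap.ker l = ⊤
    · have : coneSet u b i ∩ coneSet u b j = ∅ := by
        by_contra! hne
        obtain ⟨x, h1, h2⟩ := hne
        have hxl : ∀ v, b j * u i v = b i * u j v := by
          intro v
          have : v ∈ LinearMap.ker l := by rw [hl]; trivial
          simp only [LinearMap.mem_ker, l, LinearMap.sub_apply, LinearMap.smul_apply,
            smul_eq_mul] at this
          linarith
        -- rescale to the facet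
        have hneg := h1.1
        let r : ℝ := b i / (-(u i x))
        have hr : 0 < r := div_pos (hb2 i) (by linarith)
        have hri : r * u i x = -(b i) := by
          simp only [r]; field_simp [hneg.ne]
        have hmem : r • x ∈ polyh u b := by
          intro k
          have h3 := mul_le_mul_of_nonneg_left (h1.2.2 k) hr.le
          have h4 : 0 ≤ b i * (r * u k x + b k) := by
            have : r * (b k * u i x) = b k * (r * u i x) := by ring
            rw [this, hri] at h3
            nlinarith
          have := nonneg_of_mul_nonneg_right h4 (hb2 i)
          simpa using this
        obtain ⟨v, hv⟩ := hs b hbV _ hmem (fun k => if k = i then 1 else 0)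
        have hv1 := hv i (by simp [hri])
        have hv2 := hv j (by
          have := hxl x
          have h5 : b i * (r * u j x + b j) = 0 := by
            have h6 : b i * (r * u j x) = b j * (r * u i x) := by
              rw [show b i * (r * u j x) = r * (b i * u j x) by ring, ← this]; ring
            rw [mul_add, h6, hri]; ring
          rcases mul_eq_zero.1 h5 with h | h
          · exact absurd h (hb2 i).ne'
          · simpa using h)
        have := hxl v
        simp only [hv1, hv2, if_true, hij.symm, if_false, mul_one, mul_zero] at this
        exact (hb2 j).ne' this
      change μ (coneSet u b i ∩ coneSet u b j) = 0
      simp [this]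
    · exact measure_mono_null hsub (Measure.addHaar_submodule μ _ hl)
  have hIntegr : IntegrableOn f (⋃ i, coneSet u b i) μ :=
    ((PolyFn.cont hf).continuousOn.integrableOn_compact (bdd u hu b)).mono_set
      (Set.iUnion_subset fun i => coneSet_sub u b hb2 i)
  have h3 := integral_iUnion_ae (fun i => (coneSet_meas u b i).nullMeasurableSet) hdisj hIntegr
  rw [tsum_fintype] at h3
  have h4 : (polyh u b \ {0} : Set E) =ᵐ[μ] polyh u b := sdiff_null_ae_eq_self hzero
  rw [← setIntegral_congr_set h4, ← hun, h3]
  exact Finset.sum_congr rfl fun i _ => hb1 i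

theorem step (hE : 0 < Module.finrank ℝ E → 
    ∀ l : E →ₗ[ℝ] ℝ, l ≠ 0 → Claim (LinearMap.ker l)) : Claim E := by
  classical
  intro μ _ ι _ u b0 hu hg f hf
  -- positive case first
  have pos : ∀ b0 : ι → ℝ, (∀ i, 0 < b0 i) → Good u b0 → ∀ f ∈ PolyFn E,
      ∃ g ∈ PolyFn (ι → ℝ), ∀ᶠ b in 𝓝 b0, ∫ x in polyh u b, f x ∂μ = g b := by
    intro b0 hb0 hg f hf
    by_cases hfr : 0 < Module.finrank ℝ E
    · exact pos_case hfr (hE hfr) μ u b0 hu hg hb0 hf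
    · have hsub : Subsingleton E := (Module.finrank_zero_iff (R := ℝ) (M := E)).1 (by omega)
      have h2 : ∀ᶠ b in 𝓝 b0, ∀ j, 0 < b j := eventually_all.2 fun j =>
        (continuous_apply j).continuousAt.eventually (lt_mem_nhds (hb0 j))
      refine ⟨fun _ => ∫ x, f x ∂μ, PolyFn.const _, ?_⟩
      filter_upwards [h2] with b hb
      have : polyh u b = Set.univ := by
        ext x
        simp only [Set.mem_univ, iff_true]
        intro i
        rw [Subsingleton.elim x 0]; simpa using (hb i).le
      rw [this, setIntegral_univ]
  have hg' := hg
  obtain ⟨V, hV, hs, hcb⟩ := hg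
  have hb0V := mem_of_mem_nhds hV
  by_cases hne : (polyh u b0).Nonempty
  · obtain ⟨x, hx⟩ := hne
    obtain ⟨v, hv⟩ := hs b0 hb0V x hx (fun _ => 1)
    -- interior point
    have hc : ∃ c : E, ∀ i, 0 < u i c + b0 i := by
      have : ∀ᶠ ε in 𝓝[>] (0 : ℝ), ∀ i, 0 < u i (x + ε • v) + b0 i := by
        refine eventually_all.2 fun i => ?_
        rcases (hx i).lt_or_eq with h | h
        · have hcont : Continuous fun ε : ℝ => u i (x + ε • v) + b0 i := by
            simp only [map_add, map_smul]; fun_prop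
          have := hcont.continuousAt (x := 0)
          refine (this.eventually (lt_mem_nhds ?_)).filter_mono nhdsWithin_le_nhds
          simpa using h
        · filter_upwards [self_mem_nhdsWithin] with ε hε
          have h1 := hv i h.symm
          simp only [map_add, map_smul, h1, smul_eq_mul, mul_one]
          have : (0 : ℝ) < ε := hε
          linarith
      obtain ⟨ε, hε⟩ := this.exists
      exact ⟨_, hε⟩
    obtain ⟨c, hc⟩ := hc
    let s : ι → ℝ := fun i => u i c
    have hsh : ∀ b (y : E), y ∈ polyh u (b + s) ↔ y + c ∈ polyh u b := by
      intro b y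
      refine forall_congr' fun i => ?_
      simp only [s, Pi.add_apply, map_add]
      rw [show u i y + (b i + u i c) = u i y + u i c + b i by ring]
    have hti : ∀ b (y : E) i, u i y + (b + s) i = u i (y + c) + b i := by
      intro b y i
      simp only [s, Pi.add_apply, map_add]; ring
    have hGood : Good u (b0 + s) := by
      have hcs : Continuous fun b : ι → ℝ => b - s := by fun_prop
      refine ⟨(fun b => b - s) ⁻¹' V, hcs.continuousAt.preimage_mem_nhds (by simpa using hV),
        ?_, ?_⟩
      · intro b hb y hy β
        have hbs : b = (b - s) + s := by simp
        rw [hbs] at hy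
        obtain ⟨v, hv⟩ := hs _ hb _ ((hsh _ _).1 hy) β
        refine ⟨v, fun j hj => hv j ?_⟩
        rw [← hti]; simpa using hj
      · intro b hb b' hb' I ⟨y, hy, hyI⟩
        have hbs : b = (b - s) + s := by simp
        have hbs' : b' = (b' - s) + s := by simp
        rw [hbs] at hy
        obtain ⟨z, hz, hzI⟩ := hcb _ hb _ hb' I ⟨_, (hsh _ _).1 hy, fun i hi => by
          rw [← hti]; simpa using hyI i hi⟩
        refine ⟨z - c, ?_, fun i hi => ?_⟩
        · rw [hbs', hsh]; simpa using hz
        · rw [hbs', hti]; simpa using hzI i hi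
    obtain ⟨g, hgP, hgE⟩ := pos (b0 + s) (fun i => by simp only [s, Pi.add_apply]; linarith [hc i])
      hGood (fun x => f (x + c)) (PolyFn.comp LinearMap.id c hf)
    refine ⟨fun b => g (b + s), PolyFn.comp LinearMap.id s hgP, ?_⟩
    have hcs : Continuous fun b : ι → ℝ => b + s := by fun_prop
    filter_upwards [hcs.continuousAt.eventually hgE] with b hb
    rw [← hb, ← integral_indicator (polyh_closed _ _).measurableSet,
      ← integral_indicator (polyh_closed _ _).measurableSet,
      ← integral_add_right_eq_self _ c]
    congr 1; ext y
    simp only [Set.indicator, hsh]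
  · refine ⟨fun _ => 0, PolyFn.const 0, ?_⟩
    filter_upwards [hV] with b hb
    have : polyh u b = ∅ := by
      by_contra! h
      obtain ⟨x, hx⟩ := h
      obtain ⟨y, hy, -⟩ := hcb b hb b0 hb0V ∅ ⟨x, hx, by simp⟩
      exact hne ⟨y, hy⟩
    simp [this]

end main

theorem claim_all : ∀ (n : ℕ) (E : Type) [NormedAddCommGroup E] [NormedSpace ℝ E]
    [FiniteDimensional ℝ E] [MeasurableSpace E] [BorelSpace E], Module.finrank ℝ E = n →
    Claim E := by
  intro n
  induction n with
  | zero =>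
    intro E _ _ _ _ _ h
    exact step fun h' => by omega
  | succ n ih =>
    intro E _ _ _ _ _ h
    refine step fun _ l hl => ih _ ?_
    have h1 := LinearMap.finrank_range_add_finrank_ker l
    have h2 : LinearMap.range l = ⊤ := LinearMap.range_eq_top.2 (LinearMap.surjective hl)
    rw [h2, finrank_top, Module.finrank_self] at h1
    omega

end PolyInt

open PolyInt in
theorem polyInt_to_mv {m : ℕ} (a : Fin m → ℝ) {g : (Fin m → ℝ) → ℝ} (hg : g ∈ PolyFn (Fin m → ℝ)) :
    ∃ P : MvPolynomial (Fin (m + 1)) ℝ, ∀ (t : ℝ) (h : Fin m → ℝ),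
      g (fun i => t * a i + h i) = MvPolynomial.eval (Fin.cons t h : Fin (m + 1) → ℝ) P := by
  refine PolyFn.induct (p := fun g => ∃ P : MvPolynomial (Fin (m + 1)) ℝ, ∀ (t : ℝ) (h : Fin m → ℝ),
      g (fun i => t * a i + h i) = MvPolynomial.eval (Fin.cons t h : Fin (m + 1) → ℝ) P)
    ?_ ?_ ?_ ?_ hg
  · intro l
    refine ⟨∑ i, (MvPolynomial.X 0 * MvPolynomial.C (a i) + MvPolynomial.X i.succ) *
      MvPolynomial.C (l fun j => if i = j then 1 else 0), fun t h => ?_⟩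
    beta_reduce
    rw [LinearMap.pi_apply_eq_sum_univ l]
    simp
  · intro c; exact ⟨MvPolynomial.C c, by simp⟩
  · rintro f g ⟨p, hp⟩ ⟨q, hq⟩; exact ⟨p + q, fun t h => by beta_reduce; rw [hp, hq, map_add]⟩
  · rintro f g ⟨p, hp⟩ ⟨q, hq⟩; exact ⟨p * q, fun t h => by beta_reduce; rw [hp, hq, map_mul]⟩

open PolyInt in
theorem polyInt_of_mv {n : ℕ} (f : MvPolynomial (Fin n) ℝ) :
    (fun x => MvPolynomial.eval x f) ∈ PolyFn (Fin n → ℝ) := by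
  induction f using MvPolynomial.induction_on with
  | C c => simpa using PolyFn.const (E := Fin n → ℝ) c
  | add p q hp hq => simpa using PolyFn.add hp hq
  | mul_X p i hp =>
    simpa using PolyFn.mul hp (PolyFn.lin (LinearMap.proj i : (Fin n → ℝ) →ₗ[ℝ] ℝ))

theorem polyInt_li {κ : Type} {n : ℕ} (u : κ → Fin n → ℝ) (h : LinearIndependent ℝ u)
    (β : κ → ℝ) : ∃ v : Fin n → ℝ, ∀ k, ∑ j, v j * u k j = β k := by
  obtain ⟨φ, hφ⟩ := LinearMap.exists_extend ((Module.Basis.span h).constr ℝ β)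
  refine ⟨fun j => φ (fun i => if j = i then 1 else 0), fun k => ?_⟩
  have h1 : φ (u k) = β k := by
    have h2 := congrArg (fun F => F (Module.Basis.span h k)) hφ
    simp only [LinearMap.comp_apply, Submodule.subtype_apply] at h2
    rw [Module.Basis.constr_basis, Module.Basis.span_apply] at h2
    exact h2
  rw [← h1, LinearMap.pi_apply_eq_sum_univ φ (u k)]
  exact Finset.sum_congr rfl fun j _ => by rw [smul_eq_mul, mul_comm]

/-- For a simple polytope `Δ_{t,h} = {x : x·uᵢ + t aᵢ + hᵢ ≥ 0}` and a
polynomial `f`, the function `(t,h) ↦ ∫_{Δ_{t,h}} f` is a polynomial in `(t,h)` on a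
neighborhood of any `(t₀,h₀)` near which `Δ_{t,h}` stays simple with the same
combinatorial type. -/
theorem stmt_6 (n m : ℕ) (u : Fin m → Fin n → ℝ) (a : Fin m → ℝ) (ha : ∀ i, 0 < a i)
    (Δ : ℝ → (Fin m → ℝ) → Set (Fin n → ℝ))
    (hΔ : ∀ t h, Δ t h = {x | ∀ i, 0 ≤ (∑ j, x j * u i j) + t * a i + h i})
    (f : MvPolynomial (Fin n) ℝ)
    (t₀ : ℝ) (h₀ : Fin m → ℝ) (ht₀ : 0 < t₀)
    (U : Set (ℝ × (Fin m → ℝ))) (hU : U ∈ nhds (t₀, h₀))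
    -- near (t₀,h₀) the polytope is simple: the tight facet normals at any point
    -- of the polytope are linearly independent
    (hsimple : ∀ p ∈ U, ∀ x ∈ Δ p.1 p.2,
      LinearIndependent ℝ
        (fun i : {i : Fin m // (∑ j, x j * u i j) + p.1 * a i + p.2 i = 0} => u i))
    -- near (t₀,h₀) the combinatorial type is constant: the same collections of
    -- facets have a common point of the polytope
    (hcomb : ∀ p ∈ U, ∀ q ∈ U, ∀ I : Finset (Fin m),
      (∃ x ∈ Δ p.1 p.2, ∀ i ∈ I, (∑ j, x j * u i j) + p.1 * a i + p.2 i = 0) ↔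
      (∃ x ∈ Δ q.1 q.2, ∀ i ∈ I, (∑ j, x j * u i j) + q.1 * a i + q.2 i = 0)) :
    ∃ (P : MvPolynomial (Fin (m + 1)) ℝ) (W : Set (ℝ × (Fin m → ℝ))),
      W ∈ nhds (t₀, h₀) ∧
      ∀ p ∈ W, (∫ x in Δ p.1 p.2, MvPolynomial.eval x f)
        = MvPolynomial.eval (Fin.cons p.1 p.2) P := by
  classical
  let u' : Fin m → (Fin n → ℝ) →ₗ[ℝ] ℝ := fun i =>
    { toFun := fun x => ∑ j, x j * u i j
      map_add' := fun x y => by simp [add_mul, Finset.sum_add_distrib]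
      map_smul' := fun c x => by simp [Finset.mul_sum, mul_assoc] }
  have hu' : ∀ i x, u' i x = ∑ j, x j * u i j := fun _ _ => rfl
  have hD : ∀ t h, Δ t h = PolyInt.polyh u' (fun i => t * a i + h i) := by
    intro t h
    rw [hΔ]
    ext x
    refine forall_congr' fun i => ?_
    rw [hu', add_assoc]
  have hfP := polyInt_of_mv f
  by_cases hrec : ∀ v, (∀ i, 0 ≤ u' i v) → v = 0
  · let b0 : Fin m → ℝ := fun i => t₀ * a i + h₀ i
    let ψ : (Fin m → ℝ) → ℝ × (Fin m → ℝ) := fun b => (t₀, fun i => b i - t₀ * a i)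
    have hψ : Continuous ψ := by fun_prop
    have hψ0 : ψ b0 = (t₀, h₀) := by simp [ψ, b0]
    have hψD : ∀ b, Δ (ψ b).1 (ψ b).2 = PolyInt.polyh u' b := by
      intro b; rw [hD]; simp [ψ]
    have hψt : ∀ b i (x : Fin n → ℝ), (∑ j, x j * u i j) + (ψ b).1 * a i + (ψ b).2 i
        = u' i x + b i := by
      intro b i x; simp only [ψ, hu']; ring
    have hgood : PolyInt.Good u' b0 := by
      refine ⟨ψ ⁻¹' U, hψ.continuousAt.preimage_mem_nhds (by rwa [hψ0]), ?_, ?_⟩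
      · intro b hb x hx β
        obtain ⟨v, hv⟩ := polyInt_li _ (hsimple (ψ b) hb x (by rwa [hψD])) (fun i => β i)
        exact ⟨v, fun j hj => hv ⟨j, by rw [hψt]; exact hj⟩⟩
      · intro b hb b' hb' I hI
        have := (hcomb (ψ b) hb (ψ b') hb' I).1
        simp only [hψD, hψt] at this
        exact this hI
    obtain ⟨g, hgP, hgE⟩ := PolyInt.claim_all n (Fin n → ℝ) (by simp) volume (Fin m) u' b0 hrec
      hgood _ hfP
    obtain ⟨P, hP⟩ := polyInt_to_mv a hgP
    have hc : Continuous fun p : ℝ × (Fin m → ℝ) => (fun i => p.1 * a i + p.2 i : Fin m → ℝ) := by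
      fun_prop
    refine ⟨P, _, (hc.continuousAt (x := (t₀, h₀))).eventually hgE, fun p hp => ?_⟩
    rw [← hP, hD]
    exact hp
  · push Not at hrec
    obtain ⟨v, hv, hv0⟩ := hrec
    refine ⟨0, Set.univ, Filter.univ_mem, fun p _ => ?_⟩
    rw [hD, PolyInt.unbdd volume u' _ v hv0 hv hfP]
    simp
end

section
/- For n = 1 and Δ = [-1,1], with f(x) = (1+x²)^{s/2}: the function C(s) := Σ_{ℓ∈ℤ} (1+ℓ²)^{s/2} - ∫_{ℝ} (1+x²)^{s/2} dx, defined and holomorphic for Re s < -1, admits an analytic continuation to an entire function of s. -/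
open MeasureTheory

namespace Stmt15

open Set Filter Topology Asymptotics HurwitzZeta

lemma base_eq (x : ℝ) : (1 + (x : ℂ) ^ 2) = ((1 + x ^ 2 : ℝ) : ℂ) := by push_cast; ring

lemma norm_term (x : ℝ) (w : ℂ) : ‖(1 + (x : ℂ) ^ 2) ^ w‖ = (1 + x ^ 2) ^ w.re := by
  rw [base_eq, Complex.norm_cpow_eq_rpow_re_of_pos (by positivity)]

lemma summable_real {r : ℝ} (hr : 1 / 2 < r) :
    Summable fun l : ℤ => (1 + (l : ℝ) ^ 2) ^ (-r) := by
  have h := Real.summable_abs_int_rpow (b := 2 * r) (by linarith)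
  refine Summable.of_norm_bounded_eventually h ?_
  have : ({0} : Set ℤ)ᶜ ∈ cofinite := (Set.finite_singleton 0).compl_mem_cofinite
  filter_upwards [this] with l hl
  have hl' : (0 : ℝ) < |(l : ℝ)| := by
    have : l ≠ 0 := by simpa using hl
    positivity
  rw [Real.norm_of_nonneg (by positivity)]
  have : |(l : ℝ)| ^ (-(2 * r)) = ((l : ℝ) ^ 2) ^ (-r) := by
    rw [← sq_abs, ← Real.rpow_natCast, ← Real.rpow_mul hl'.le]
    congr 1; push_cast; ring
  rw [this]
  have h2 : 0 < (l : ℝ) ^ 2 := by rw [← sq_abs]; positivity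
  exact Real.rpow_le_rpow_of_nonpos h2 (by linarith) (by linarith)

lemma integrable_real {r : ℝ} (hr : 1 / 2 < r) :
    Integrable fun x : ℝ => (1 + x ^ 2) ^ (-r) := by
  have h := integrable_rpow_neg_one_add_norm_sq (E := ℝ) (μ := volume) (r := 2 * r)
    (by simp; linarith)
  convert h using 2 with x
  rw [Real.norm_eq_abs, sq_abs]
  congr 1; ring

lemma summable_cx {a : ℂ} (ha : 1 / 2 < a.re) :
    Summable fun l : ℤ => (1 + (l : ℂ) ^ 2) ^ (-a) := by
  refine Summable.of_norm ?_
  convert summable_real ha using 2 with l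
  simpa using norm_term (l : ℝ) (-a)

lemma integrable_cx {a : ℂ} (ha : 1 / 2 < a.re) :
    Integrable fun x : ℝ => (1 + (x : ℂ) ^ 2) ^ (-a) := by
  refine (integrable_real ha).mono' ?_ ?_
  · exact (by fun_prop : Measurable fun x : ℝ => (1 + (x : ℂ) ^ 2) ^ (-a)).aestronglyMeasurable
  · exact Eventually.of_forall fun x => by rw [norm_term]; simp

/-- The difference kernel, rapidly decaying at both ends. -/
noncomputable def H (t : ℝ) : ℂ :=
  (Real.exp (-Real.pi * t) : ℂ) * ((evenKernel 0 t : ℂ) - ((t ^ (-(1 / 2) : ℝ) : ℝ) : ℂ))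

noncomputable def F (t : ℝ) : ℂ :=
  (Real.exp (-Real.pi * t) : ℂ) * (evenKernel 0 t : ℂ)

noncomputable def G (t : ℝ) : ℂ :=
  (Real.exp (-Real.pi * t) : ℂ) * ((t ^ (-(1 / 2) : ℝ) : ℝ) : ℂ)

lemma H_loc : LocallyIntegrableOn H (Ioi 0) := by
  refine ContinuousOn.locallyIntegrableOn ?_ measurableSet_Ioi
  refine ContinuousOn.mul (by fun_prop) (ContinuousOn.sub ?_ ?_)
  · exact Complex.continuous_ofReal.comp_continuousOn (continuousOn_evenKernel 0)
  · refine Complex.continuous_ofReal.comp_continuousOn ?_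
    intro x hx
    exact (Real.continuousAt_rpow_const _ _ (Or.inl (ne_of_gt hx))).continuousWithinAt

lemma G_loc : LocallyIntegrableOn G (Ioi 0) := by
  refine ContinuousOn.locallyIntegrableOn ?_ measurableSet_Ioi
  refine ContinuousOn.mul (by fun_prop) ?_
  refine Complex.continuous_ofReal.comp_continuousOn ?_
  intro x hx
  exact (Real.continuousAt_rpow_const _ _ (Or.inl (ne_of_gt hx))).continuousWithinAt

lemma exp_isBigO (l : Filter ℝ) : (fun t : ℝ => (Real.exp (-Real.pi * t) : ℂ)) =O[l]
    fun t => Real.exp (-Real.pi * t) := by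
  refine IsBigO.of_bound 1 (Eventually.of_forall fun t => ?_)
  simp only [Complex.norm_real, one_mul, le_refl]

lemma pow_top : (fun t : ℝ => ((t ^ (-(1 / 2) : ℝ) : ℝ) : ℂ)) =O[atTop] fun _ => (1 : ℝ) := by
  refine IsBigO.of_bound 1 ?_
  filter_upwards [eventually_ge_atTop 1] with t ht
  rw [Complex.norm_real, Real.norm_of_nonneg (by positivity)]
  simpa using Real.rpow_le_one_of_one_le_of_nonpos ht (by norm_num : (-(1 / 2) : ℝ) ≤ 0)

lemma ker_top : (fun t : ℝ => (evenKernel 0 t : ℂ)) =O[atTop] fun _ => (1 : ℝ) := by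
  obtain ⟨p, hp, h⟩ := isBigO_atTop_evenKernel_sub 0
  simp only [if_true] at h
  rw [Complex.isBigO_ofReal_left]
  have h1 : (fun x : ℝ => Real.exp (-p * x)) =O[atTop] fun _ => (1 : ℝ) := by
    refine IsBigO.of_bound 1 ?_
    filter_upwards [eventually_ge_atTop 0] with t ht
    rw [Real.norm_of_nonneg (by positivity)]
    simp; positivity
  have := (h.trans h1).add (isBigO_refl (fun _ : ℝ => (1 : ℝ)) atTop)
  simpa using this

lemma H_top : H =O[atTop] fun t => Real.exp (-Real.pi * t) := by
  simpa [show H = _ from funext fun t => H.eq_1 t] using (exp_isBigO atTop).mul (ker_top.sub pow_top)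

lemma G_top : G =O[atTop] fun t => Real.exp (-Real.pi * t) := by
  simpa [show G = _ from funext fun t => G.eq_1 t] using (exp_isBigO atTop).mul pow_top

lemma exp_zero_bd : (fun t : ℝ => (Real.exp (-Real.pi * t) : ℂ)) =O[𝓝[>] 0]
    fun _ => (1 : ℝ) := by
  refine IsBigO.of_bound 1 ?_
  filter_upwards [self_mem_nhdsWithin] with t ht
  have ht' : (0 : ℝ) < t := ht
  rw [Complex.norm_real, Real.norm_of_nonneg (by positivity)]
  simp; positivity

lemma H_zero (r : ℝ) : H =O[𝓝[>] 0] (· ^ r) := by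
  have h := (hurwitzEvenFEPair 0).hf_zero r
  have h' : (fun t : ℝ => (evenKernel 0 t : ℂ) - ((t ^ (-(1 / 2) : ℝ) : ℝ) : ℂ))
      =O[𝓝[>] 0] (· ^ r) := by
    simpa [hurwitzEvenFEPair] using h
  simpa [show H = _ from funext fun t => H.eq_1 t] using exp_zero_bd.mul h'

lemma G_zero : G =O[𝓝[>] 0] (· ^ (-(1 / 2) : ℝ)) := by
  have h : (fun t : ℝ => ((t ^ (-(1 / 2) : ℝ) : ℝ) : ℂ)) =O[𝓝[>] 0] (· ^ (-(1 / 2) : ℝ)) :=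
    Complex.isBigO_ofReal_left.mpr (isBigO_refl _ _)
  simpa [show G = _ from funext fun t => G.eq_1 t] using exp_zero_bd.mul h

lemma H_diff : Differentiable ℂ (mellin H) := fun s =>
  mellin_differentiableAt_of_isBigO_rpow_exp (b := s.re - 1) Real.pi_pos H_loc H_top (H_zero _)
    (by linarith)

lemma H_conv (s : ℂ) : MellinConvergent H s :=
  mellinConvergent_of_isBigO_rpow_exp (b := s.re - 1) Real.pi_pos H_loc H_top (H_zero _)
    (by linarith)

lemma G_conv {s : ℂ} (hs : 1 / 2 < s.re) : MellinConvergent G s :=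
  mellinConvergent_of_isBigO_rpow_exp (b := 1 / 2) Real.pi_pos G_loc G_top G_zero hs

lemma mellin_F {s : ℂ} (hs : 1 / 2 < s.re) : mellin F s = mellin H s + mellin G s := by
  have h := (hasMellin_add (H_conv s) (G_conv hs)).2
  rw [← h]
  congr 1
  funext t
  simp only [F, G, H]
  ring

lemma mellin_F_sum {a : ℂ} (ha : 1 / 2 < a.re) :
    mellin F a = (Real.pi : ℂ) ^ (-a) * Complex.Gamma a * ∑' l : ℤ, (1 + (l : ℂ) ^ 2) ^ (-a) := by
  have h := hasSum_mellin_pi_mul (a := fun _ : ℤ => (1 : ℂ)) (q := fun l : ℤ => 1 + (l : ℝ) ^ 2)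
    (F := F) (s := a) (fun i => Or.inr (by positivity)) (by linarith) ?_ ?_
  · rw [← h.tsum_eq, ← tsum_mul_left]
    congr 1
    funext l
    rw [Complex.cpow_neg (1 + (l : ℂ) ^ 2)]
    push_cast
    ring
  · intro t ht
    have h0 := hasSum_int_evenKernel 0 (t := t) ht
    have h1 := (Complex.hasSum_ofReal.mpr h0).mul_left (Real.exp (-Real.pi * t) : ℂ)
    convert! h1 using 2 with l
    rw [one_mul, ← Complex.ofReal_mul, ← Real.exp_add]
    congr 2; ring
  · convert summable_real ha using 2 with l
    rw [Real.rpow_neg (by positivity)]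
    simp

lemma gauss {t : ℝ} (ht : 0 < t) :
    ∫ u : ℝ, Real.exp (-(Real.pi * (1 + u ^ 2) * t)) =
      Real.exp (-Real.pi * t) * t ^ (-(1 / 2) : ℝ) := by
  have h := integral_gaussian (Real.pi * t)
  have : ∀ u : ℝ, Real.exp (-(Real.pi * (1 + u ^ 2) * t)) =
      Real.exp (-Real.pi * t) * Real.exp (-(Real.pi * t) * u ^ 2) := by
    intro u; rw [← Real.exp_add]; congr 1; ring
  simp_rw [this]
  rw [integral_const_mul, h]
  congr 1
  have : Real.pi / (Real.pi * t) = t⁻¹ := by field_simp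
  rw [this, Real.sqrt_eq_rpow, Real.inv_rpow ht.le, Real.rpow_neg ht.le]

noncomputable def K (a : ℂ) (u t : ℝ) : ℂ :=
  (t : ℂ) ^ (a - 1) * (Real.exp (-(Real.pi * (1 + u ^ 2) * t)) : ℂ)

lemma K_int {a : ℂ} (ha : 0 < a.re) (u : ℝ) :
    ∫ t in Ioi (0 : ℝ), K a u t =
      (Real.pi : ℂ) ^ (-a) * Complex.Gamma a * (1 + (u : ℂ) ^ 2) ^ (-a) := by
  have hp : 0 < Real.pi * (1 + u ^ 2) := by positivity
  have h := Complex.integral_cpow_mul_exp_neg_mul_Ioi ha hp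
  have e : (1 / ((Real.pi * (1 + u ^ 2) : ℝ) : ℂ)) ^ a =
      (Real.pi : ℂ) ^ (-a) * (1 + (u : ℂ) ^ 2) ^ (-a) := by
    rw [base_eq, ← Complex.mul_cpow_ofReal_nonneg Real.pi_pos.le (by positivity),
      ← Complex.ofReal_mul, one_div, Complex.inv_cpow, Complex.cpow_neg]
    rw [Complex.arg_ofReal_of_nonneg hp.le]; exact Real.pi_pos.ne
  rw [e] at h
  rw [mul_right_comm, ← h]
  simp only [K]
  push_cast
  rfl

lemma K_norm (a : ℂ) (u : ℝ) {t : ℝ} (ht : 0 < t) :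
    ‖K a u t‖ = t ^ (a.re - 1) * Real.exp (-(Real.pi * (1 + u ^ 2) * t)) := by
  rw [K, norm_mul, Complex.norm_cpow_eq_rpow_re_of_pos ht, Complex.norm_real,
    Real.norm_of_nonneg (Real.exp_pos _).le]
  simp

lemma K_meas (a : ℂ) : Measurable (Function.uncurry (K a)) := by
  unfold K Function.uncurry
  fun_prop

lemma K_integrable {a : ℂ} (ha : 1 / 2 < a.re) :
    Integrable (Function.uncurry (K a)) (volume.prod (volume.restrict (Ioi (0 : ℝ)))) := by
  rw [integrable_prod_iff (K_meas a).aestronglyMeasurable]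
  have ha' : 0 < a.re := by linarith
  have hn : ∀ u : ℝ, ∫ t in Ioi (0 : ℝ), ‖K a u t‖ =
      (Real.pi ^ (-a.re) * Real.Gamma a.re) * (1 + u ^ 2) ^ (-a.re) := by
    intro u
    have hp : 0 < Real.pi * (1 + u ^ 2) := by positivity
    rw [setIntegral_congr_fun measurableSet_Ioi (fun t ht => K_norm a u ht),
      Real.integral_rpow_mul_exp_neg_mul_Ioi ha' hp, one_div, Real.inv_rpow hp.le,
      ← Real.rpow_neg hp.le, Real.mul_rpow Real.pi_pos.le (by positivity)]
    ring
  constructor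
  · refine Eventually.of_forall fun u => ?_
    by_contra hcon
    have h0 := hn u
    have hm : ¬ Integrable (fun t => ‖K a u t‖) (volume.restrict (Ioi (0 : ℝ))) := by
      intro h
      refine hcon ?_
      refine (integrable_norm_iff ?_).mp h
      exact ((K_meas a).comp measurable_prodMk_left).aestronglyMeasurable
    rw [integral_undef hm] at h0
    have : 0 < (Real.pi ^ (-a.re) * Real.Gamma a.re) * (1 + u ^ 2) ^ (-a.re) := by
      have := Real.Gamma_pos_of_pos ha'
      positivity
    linarith
  · simp only [Function.uncurry]
    simp_rw [hn]
    exact (integrable_real ha).const_mul _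

lemma mellin_G_int {a : ℂ} (ha : 1 / 2 < a.re) :
    mellin G a = (Real.pi : ℂ) ^ (-a) * Complex.Gamma a * ∫ x : ℝ, (1 + (x : ℂ) ^ 2) ^ (-a) := by
  have h := integral_integral_swap (K_integrable ha)
  simp_rw [K_int (by linarith : 0 < a.re)] at h
  rw [integral_const_mul] at h
  rw [h, mellin]
  refine setIntegral_congr_fun measurableSet_Ioi fun t ht => ?_
  simp only [K, smul_eq_mul, G]
  rw [integral_const_mul, integral_complex_ofReal, gauss ht, Complex.ofReal_mul]

/-- The entire continuation. -/
noncomputable def E (s : ℂ) : ℂ :=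
  (Real.pi : ℂ) ^ (-s / 2) * (Complex.Gamma (-s / 2))⁻¹ * mellin H (-s / 2)

lemma E_diff : Differentiable ℂ E := by
  have hl : Differentiable ℂ fun s : ℂ => -s / 2 := by fun_prop
  have hpi : (Real.pi : ℂ) ≠ 0 := by exact_mod_cast Real.pi_ne_zero
  refine (Differentiable.mul ?_ ?_).mul (H_diff.comp hl)
  · exact hl.const_cpow (Or.inl hpi)
  · exact Complex.differentiable_one_div_Gamma.comp hl

lemma E_eq {s : ℂ} (hs : s.re < -1) :
    E s = (∑' l : ℤ, (1 + (l : ℂ) ^ 2) ^ (s / 2)) - ∫ x : ℝ, (1 + (x : ℂ) ^ 2) ^ (s / 2) := by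
  obtain ⟨a, rfl⟩ : ∃ a : ℂ, s = -(2 * a) := ⟨-s / 2, by ring⟩
  have ha : 1 / 2 < a.re := by simp at hs; linarith
  have e1 : -(-(2 * a)) / 2 = a := by ring
  have e2 : -(2 * a) / 2 = -a := by ring
  rw [E, e1, e2]
  have h := mellin_F ha
  rw [mellin_F_sum ha, mellin_G_int ha] at h
  have hpi : (Real.pi : ℂ) ≠ 0 := by exact_mod_cast Real.pi_ne_zero
  have hG : Complex.Gamma a ≠ 0 := Complex.Gamma_ne_zero_of_re_pos (by linarith)
  have hpa : (Real.pi : ℂ) ^ a ≠ 0 := by simp [Complex.cpow_eq_zero_iff, hpi]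
  rw [Complex.cpow_neg (Real.pi : ℂ)] at h
  generalize (∑' l : ℤ, (1 + (l : ℂ) ^ 2) ^ (-a)) = S at h ⊢
  generalize (∫ x : ℝ, (1 + (x : ℂ) ^ 2) ^ (-a)) = T at h ⊢
  rw [eq_sub_of_add_eq h.symm]
  field_simp

end Stmt15

/-- For `n = 1`, the function
`C(s) = Σ_{ℓ∈ℤ} (1+ℓ²)^{s/2} - ∫_ℝ (1+x²)^{s/2} dx` is well defined and holomorphic
on `Re s < -1` and admits an analytic continuation to an entire function of `s`. -/
theorem stmt_15 (C : ℂ → ℂ)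
    (hC : ∀ s : ℂ, s.re < -1 →
      C s = (∑' ℓ : ℤ, (1 + (ℓ : ℂ) ^ 2) ^ (s / 2)) - ∫ x : ℝ, (1 + (x : ℂ) ^ 2) ^ (s / 2)) :
    (∀ s : ℂ, s.re < -1 →
      (Summable fun ℓ : ℤ => (1 + (ℓ : ℂ) ^ 2) ^ (s / 2)) ∧
        Integrable fun x : ℝ => (1 + (x : ℂ) ^ 2) ^ (s / 2)) ∧
      DifferentiableOn ℂ C {s : ℂ | s.re < -1} ∧
      ∃ E : ℂ → ℂ, Differentiable ℂ E ∧ ∀ s : ℂ, s.re < -1 → E s = C s := by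
  have hh : ∀ s : ℂ, s.re < -1 → 1 / 2 < (-(s / 2)).re := by
    intro s hs
    simp
    linarith
  have hE : ∀ s : ℂ, s.re < -1 → Stmt15.E s = C s := fun s hs => by
    rw [hC s hs, Stmt15.E_eq hs]
  refine ⟨fun s hs => ⟨?_, ?_⟩, ?_, Stmt15.E, Stmt15.E_diff, hE⟩
  · simpa using Stmt15.summable_cx (hh s hs)
  · simpa using Stmt15.integrable_cx (hh s hs)
  · exact Stmt15.E_diff.differentiableOn.congr fun s hs => (hE s hs).symm
end
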